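/- arXiv:1602.07944 — 4 statements merged into one kernel-verified Lean document; each statement's English description precedes it below -/
import Mathlib

section
/- For every even positive integer w there exists a w-cyclic 3-IGDD of type (2w,w)^8. -/
/-- A w-cyclic 3-IGDD of type (vw,tw)^u: blocks on `I_u × I_v × Z_w` with
groups `{i} × I_v × Z_w` (i ∈ I_u) and hole `Y = I_u × I_t × Z_w` (the points
whose middle coordinate is < t). Every block meets each group in at most one
point, no block contains two points of Y, every pair of points from distinct
groups not both in Y lies in exactly one block, and the cyclic shift of the
last coordinate maps the block set onto itself. -/
def IsCyclicIGDDrow (u v w t : ℕ)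
    (ℬ : Finset (Finset (Fin u × Fin v × ZMod w))) : Prop :=
  (∀ B ∈ ℬ, B.card = 3) ∧
  (∀ B ∈ ℬ, ∀ p ∈ B, ∀ q ∈ B, p ≠ q →
    p.1 ≠ q.1 ∧ ¬((p.2.1 : ℕ) < t ∧ (q.2.1 : ℕ) < t)) ∧
  (∀ p q : Fin u × Fin v × ZMod w, p.1 ≠ q.1 →
    ¬((p.2.1 : ℕ) < t ∧ (q.2.1 : ℕ) < t) →
    ∃! B, B ∈ ℬ ∧ p ∈ B ∧ q ∈ B) ∧
  (∀ B ∈ ℬ, B.image (fun p => (p.1, p.2.1, p.2.2 + 1)) ∈ ℬ)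

namespace CyclicIGDD

open Finset

section Blocks

variable {u w : ℕ}

/-- The block through the hole point `(i, 0, x)` and the translates by `x` of the points
`p` and `f i p`. -/
def block (f : Fin u → Fin u × ZMod w → Fin u × ZMod w) (i : Fin u) (x : ZMod w)
    (p : Fin u × ZMod w) : Finset (Fin u × Fin 2 × ZMod w) :=
  {(i, 0, x), (p.1, 1, x + p.2), ((f i p).1, 1, x + (f i p).2)}

variable {f : Fin u → Fin u × ZMod w → Fin u × ZMod w} {i : Fin u} {x : ZMod w}
  {p : Fin u × ZMod w}

lemma hole_mem_block {j : Fin u} {y : ZMod w} :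
    (j, (0 : Fin 2), y) ∈ block f i x p ↔ j = i ∧ y = x := by
  simp [block]

lemma nonhole_mem_block {j : Fin u} {y : ZMod w} :
    (j, (1 : Fin 2), y) ∈ block f i x p ↔ (j, y - x) = p ∨ (j, y - x) = f i p := by
  simp [block, Prod.ext_iff, sub_eq_iff_eq_add']

lemma block_partner (h : f i (f i p) = p) : block f i x (f i p) = block f i x p := by
  simp only [block, h]
  congr 1
  exact Finset.pair_comm _ _

lemma eq_block_of_mem {j : Fin u} {y : ZMod w} (h : f i (f i p) = p)
    (hj : (j, (1 : Fin 2), y) ∈ block f i x p) : block f i x p = block f i x (j, y - x) := by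
  rcases nonhole_mem_block.1 hj with e | e
  · rw [e]
  · rw [e, block_partner h]

/-- A family of pairings `f i` of the points outside group `i` in which every mixed difference
occurs exactly once yields a cyclic incomplete group divisible design. -/
theorem exists_of_pairing [NeZero w]
    (hf : ∀ i p, p.1 ≠ i → (f i p).1 ≠ i ∧ (f i p).1 ≠ p.1 ∧ f i (f i p) = p)
    (hd : ∀ a b, a ≠ b → ∀ d : ZMod w,
      ∃! q : Fin u × ZMod w, q.1 ≠ a ∧ f q.1 (a, q.2) = (b, q.2 + d)) :
    ∃ ℬ : Finset (Finset (Fin u × Fin 2 × ZMod w)), IsCyclicIGDDrow u 2 w 1 ℬ := by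
  classical
  obtain ⟨ℬ, hℬ⟩ : ∃ ℬ : Finset (Finset (Fin u × Fin 2 × ZMod w)),
      ∀ B, B ∈ ℬ ↔ ∃ i x p, p.1 ≠ i ∧ block f i x p = B := by
    refine ⟨(univ.filter fun q : Fin u × ZMod w × Fin u × ZMod w => q.2.2.1 ≠ q.1).image
      fun q => block f q.1 q.2.1 q.2.2, fun B => ?_⟩
    simp
  have hmixed : ∀ i x a y, a ≠ i →
      ∃! B, B ∈ ℬ ∧ (i, (0 : Fin 2), x) ∈ B ∧ (a, (1 : Fin 2), y) ∈ B := by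
    intro i x a y hai
    refine ⟨block f i x (a, y - x), ⟨(hℬ _).2 ⟨_, _, _, hai, rfl⟩, hole_mem_block.2 ⟨rfl, rfl⟩,
      nonhole_mem_block.2 (Or.inl rfl)⟩, ?_⟩
    rintro B ⟨hB, h0, h1⟩
    obtain ⟨j, x', p, hp, rfl⟩ := (hℬ B).1 hB
    obtain ⟨rfl, rfl⟩ := hole_mem_block.1 h0
    exact eq_block_of_mem (hf _ _ hp).2.2 h1
  refine ⟨ℬ, ?_, ?_, ?_, ?_⟩
  · intro B hB
    obtain ⟨i, x, p, hp, rfl⟩ := (hℬ B).1 hB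
    exact Finset.card_eq_three.2 ⟨_, _, _, by simp, by simp,
      fun h => (hf i p hp).2.1 (congrArg Prod.fst h).symm, rfl⟩
  · intro B hB
    obtain ⟨i, x, p, hp, rfl⟩ := (hℬ B).1 hB
    obtain ⟨h1, h2, -⟩ := hf i p hp
    intro q hq r hr hqr
    simp only [block, mem_insert, mem_singleton] at hq hr
    rcases hq with rfl | rfl | rfl <;> rcases hr with rfl | rfl | rfl <;>
      first
        | exact absurd rfl hqr
        | simp [hp, h1, h2, hp.symm, h1.symm, h2.symm]
  · rintro ⟨a, j, y⟩ ⟨b, k, z⟩ hab hjk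
    have hab' : a ≠ b := hab
    fin_cases j <;> fin_cases k
    · simp at hjk
    · exact hmixed a y b z hab'.symm
    · simpa [and_comm] using hmixed b z a y hab'
    · obtain ⟨⟨i, s⟩, ⟨hia, his⟩, huniq⟩ := hd a b hab' (z - y)
      simp only at hia his
      refine ⟨block f i (y - s) (a, s), ⟨(hℬ _).2 ⟨_, _, _, hia.symm, rfl⟩,
        nonhole_mem_block.2 (Or.inl ?_), nonhole_mem_block.2 (Or.inr ?_)⟩, ?_⟩
      · simp
      · rw [his]
        congr 1
        ring
      · rintro B ⟨hB, h1, h2⟩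
        obtain ⟨i', x, p, hp, rfl⟩ := (hℬ B).1 hB
        have e := eq_block_of_mem (hf _ _ hp).2.2 h1
        have hai' : a ≠ i' := by
          rcases nonhole_mem_block.1 h1 with e | e
          · rw [← e] at hp
            exact hp
          · have := (hf _ _ hp).1
            rw [← e] at this
            exact this
        change (b, (1 : Fin 2), z) ∈ _ at h2
        rw [e] at h2 ⊢
        rcases nonhole_mem_block.1 h2 with e2 | e2
        · exact absurd (congrArg Prod.fst e2).symm hab'
        · have := huniq (i', y - x) ⟨hai'.symm, by
            rw [← e2]
            congr 1
            ring⟩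
          obtain ⟨rfl, rfl⟩ := Prod.ext_iff.1 this
          simp
  · intro B hB
    obtain ⟨i, x, p, hp, rfl⟩ := (hℬ B).1 hB
    refine (hℬ _).2 ⟨i, x + 1, p, hp, ?_⟩
    simp [block, image_insert, add_right_comm]

end Blocks

section Table

/-- The level of `a` relative to `i`, where `Fin 8` is read as `ℤ/7` with `7` as point at
infinity. -/
def relLevel (i a : Fin 8) : Fin 8 :=
  if a = 7 then 7 else Fin.ofNat 8 ((a.val + 7 - i.val) % 7)

/-- The level whose level relative to `i` is `a`. -/
def absLevel (i a : Fin 8) : Fin 8 :=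
  if a = 7 then 7 else Fin.ofNat 8 ((a.val + i.val) % 7)

/-- The pairing of half levels outside group `0`. -/
def basePartner : Fin 8 → Fin 2 → Fin 8 × Fin 2 :=
  ![![(0, 0), (0, 0)], ![(2, 0), (3, 0)], ![(1, 0), (5, 0)], ![(1, 1), (6, 1)],
    ![(6, 0), (7, 0)], ![(2, 1), (7, 1)], ![(4, 0), (3, 1)], ![(4, 1), (5, 1)]]

/-- The pairing of half levels outside group `i`. -/
def partner (i : Fin 8) (p : Fin 8 × Fin 2) : Fin 8 × Fin 2 :=
  if i = 7 then
    if p.2 = 0 then (absLevel 1 p.1, 1) else (absLevel 6 p.1, 0)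
  else
    let q := basePartner (relLevel i p.1) p.2
    (absLevel i q.1, q.2)

/-- Whether level `a` is cut at a shifted position in the pairing outside group `i`. -/
def cut (i a : Fin 8) : ℕ :=
  if i = 7 then 0 else (![0, 0, 1, 0, 1, 0, 0, 0] : Fin 8 → ℕ) (relLevel i a)

lemma partner_spec : ∀ (i : Fin 8) (p : Fin 8 × Fin 2), p.1 ≠ i →
    (partner i p).1 ≠ i ∧ (partner i p).1 ≠ p.1 ∧ partner i (partner i p) = p := by
  decide +kernel

lemma existsUnique_partner : ∀ (r d : ZMod 2) (a b : Fin 8), a ≠ b →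
    ∃! q : Fin 8 × Fin 2, q.1 ≠ a ∧ (partner q.1 (a, q.2)).1 = b ∧
      (cut q.1 a + cut q.1 b : ZMod 2) * (r + 1) +
        ((q.2.val : ZMod 2) + ((partner q.1 (a, q.2)).2.val : ZMod 2) + 1) * r + 1 = d := by
  unfold ExistsUnique
  decide +kernel

end Table

section Reflection

variable {m : ℕ}

lemma exists_half [NeZero m] (o y : ZMod (2 * m)) :
    ∃ (e : Fin 2) (t : ℕ), t < m ∧ y = o + e.val * m + t := by
  have hm := NeZero.pos m
  have hv := ZMod.val_lt (y - o)
  refine ⟨⟨(y - o).val / m, (Nat.div_lt_iff_lt_mul hm).2 hv⟩, (y - o).val % m,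
    Nat.mod_lt _ hm, ?_⟩
  have h : (((y - o).val / m * m + (y - o).val % m : ℕ) : ZMod (2 * m)) = y - o := by
    rw [Nat.div_add_mod', ZMod.natCast_zmod_val]
  push_cast at h
  rw [add_assoc, h]
  ring

/-- The half of the residues, counted from `o`, that contains `y`. -/
def half (o y : ZMod (2 * m)) : Fin 2 := Fin.ofNat 2 ((y - o).val / m)

lemma half_eq (o : ZMod (2 * m)) (e : Fin 2) {t : ℕ} (ht : t < m) :
    half o (o + e.val * m + t) = e := by
  have hm : 0 < m := by omega
  have h : o + e.val * m + t - o = ((e.val * m + t : ℕ) : ZMod (2 * m)) := by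
    push_cast
    ring
  have hlt : e.val * m + t < 2 * m := by
    have := e.isLt
    nlinarith
  rw [half, h, ZMod.val_natCast_of_lt hlt, Nat.add_comm, Nat.add_mul_div_right _ _ hm,
    Nat.div_eq_of_lt ht]
  ext
  simp

/-- The position at which level `a` is cut in the pairing outside group `i`. -/
def offset (m : ℕ) (i a : Fin 8) : ZMod (2 * m) := cut i a * (m + 1)

/-- The pairing outside group `i`, matching half levels by reflections. -/
def reflect (m : ℕ) (i : Fin 8) (p : Fin 8 × ZMod (2 * m)) : Fin 8 × ZMod (2 * m) :=
  let e := half (offset m i p.1) p.2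
  let q := partner i (p.1, e)
  (q.1, offset m i p.1 + offset m i q.1 + (e.val + q.2.val + 1) * m - 1 - p.2)

lemma reflect_eq (i a : Fin 8) (e : Fin 2) {t : ℕ} (ht : t < m) :
    reflect m i (a, offset m i a + e.val * m + t) =
      ((partner i (a, e)).1, offset m i (partner i (a, e)).1 +
        (partner i (a, e)).2.val * m + (m - 1 - t : ℕ)) := by
  simp only [reflect, half_eq _ _ ht]
  rw [Nat.cast_sub (by omega), Nat.cast_sub (by omega)]
  congr 1
  push_cast
  ring

lemma reflect_spec [NeZero m] (i : Fin 8) (p : Fin 8 × ZMod (2 * m)) (hp : p.1 ≠ i) :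
    (reflect m i p).1 ≠ i ∧ (reflect m i p).1 ≠ p.1 ∧ reflect m i (reflect m i p) = p := by
  obtain ⟨a, y⟩ := p
  obtain ⟨e, t, ht, rfl⟩ := exists_half (offset m i a) y
  obtain ⟨h1, h2, h3⟩ := partner_spec i (a, e) hp
  rw [reflect_eq i a e ht]
  refine ⟨h1, h2, ?_⟩
  rw [reflect_eq i _ _ (show m - 1 - t < m by omega), h3,
    show m - 1 - (m - 1 - t) = t by omega]

/-- The difference realised by the reflection between two half levels. -/
lemma reflect_eq_add_iff (i a b : Fin 8) (e : Fin 2) {t : ℕ} (ht : t < m) (d : ZMod (2 * m)) :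
    reflect m i (a, offset m i a + e.val * m + t) = (b, offset m i a + e.val * m + t + d) ↔
      (partner i (a, e)).1 = b ∧
        offset m i b - offset m i a + ((partner i (a, e)).2.val - e.val + 1) * m - 1 - d =
          ((2 * t : ℕ) : ZMod (2 * m)) := by
  rw [reflect_eq i a e ht, Nat.cast_sub (by omega), Nat.cast_sub (by omega), Prod.mk.injEq]
  refine and_congr_right fun hb => ?_
  rw [hb]
  push_cast
  constructor <;> intro h <;> linear_combination h

lemma even_iff_exists [NeZero m] (z : ZMod (2 * m)) :
    ZMod.castHom (dvd_mul_right 2 m) (ZMod 2) z = 0 ↔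
      ∃ t < m, z = ((2 * t : ℕ) : ZMod (2 * m)) := by
  constructor
  · intro h
    have hv := ZMod.val_lt z
    rw [← ZMod.natCast_zmod_val z, map_natCast, ZMod.natCast_eq_zero_iff] at h
    obtain ⟨t, ht⟩ := h
    exact ⟨t, by omega, by rw [← ht, ZMod.natCast_zmod_val]⟩
  · rintro ⟨t, -, rfl⟩
    rw [map_natCast, ZMod.natCast_eq_zero_iff]
    exact dvd_mul_right 2 t

lemma castHom_difference (i a b : Fin 8) (e e' : Fin 2) (d : ZMod (2 * m)) :
    ZMod.castHom (dvd_mul_right 2 m) (ZMod 2)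
        (offset m i b - offset m i a + (e'.val - e.val + 1) * m - 1 - d) = 0 ↔
      (cut i a + cut i b : ZMod 2) * (m + 1) + ((e.val : ZMod 2) + e'.val + 1) * m + 1 =
        ZMod.castHom (dvd_mul_right 2 m) (ZMod 2) d := by
  simp only [offset, map_sub, map_add, map_mul, map_natCast, map_one, CharTwo.sub_eq_add]
  rw [CharTwo.add_eq_zero]
  constructor <;> intro h <;> rw [← h] <;> ring

lemma existsUnique_reflect [NeZero m] (a b : Fin 8) (hab : a ≠ b) (d : ZMod (2 * m)) :
    ∃! q : Fin 8 × ZMod (2 * m), q.1 ≠ a ∧ reflect m q.1 (a, q.2) = (b, q.2 + d) := by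
  obtain ⟨⟨i, e⟩, ⟨hia, hb, hpar⟩, huniq⟩ :=
    existsUnique_partner m (ZMod.castHom (dvd_mul_right 2 m) (ZMod 2) d) a b hab
  simp only at hia hb hpar
  obtain ⟨t, ht, h⟩ := (even_iff_exists _).1 ((castHom_difference i a b e _ d).2 hpar)
  refine ⟨(i, offset m i a + e.val * m + t), ⟨hia, (reflect_eq_add_iff i a b e ht d).2 ⟨hb, h⟩⟩,
    ?_⟩
  rintro ⟨i', y⟩ ⟨hia', hy⟩
  simp only at hia' hy
  obtain ⟨e', t', ht', rfl⟩ := exists_half (offset m i' a) y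
  obtain ⟨hb', h'⟩ := (reflect_eq_add_iff i' a b e' ht' d).1 hy
  have hpar' := (castHom_difference i' a b e' _ d).1 ((even_iff_exists _).2 ⟨t', ht', h'⟩)
  obtain ⟨rfl, rfl⟩ := Prod.ext_iff.1 (huniq (i', e') ⟨hia', hb', hpar'⟩)
  have htt := (ZMod.natCast_eq_natCast_iff' _ _ _).1 (h'.symm.trans h)
  rw [Nat.mod_eq_of_lt (by omega), Nat.mod_eq_of_lt (by omega)] at htt
  rw [show t' = t by omega]

end Reflection

end CyclicIGDD

/-- For every even positive integer w there exists a w-cyclic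
3-IGDD of type (2w,w)^8. -/
theorem exists_cyclic_igdd_2w_w_8 (w : ℕ) (hw : 0 < w) (heven : w % 2 = 0) :
    ∃ ℬ : Finset (Finset (Fin 8 × Fin 2 × ZMod w)),
      IsCyclicIGDDrow 8 2 w 1 ℬ := by
  obtain ⟨m, rfl⟩ := Nat.dvd_of_mod_eq_zero heven
  have : NeZero m := ⟨by omega⟩
  exact CyclicIGDD.exists_of_pairing CyclicIGDD.reflect_spec CyclicIGDD.existsUnique_reflect
end

section
/- Let v be a positive integer with v ≡ 1 or 2 (mod 3) and v ≥ 2. Then for every even positive integer w there exists a w-cyclic 3-IGDD of type (vw,w)^8. -/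
namespace CyclicIGDD

/-- The first coordinates of the eight starter triangles, with the groups indexed by `Z_7 ∪ {∞}`. -/
def vert : Fin 8 → Fin 3 → Option (Fin 7) :=
  ![![some 0, some 1, some 4], ![some 0, some 1, none], ![some 0, some 2, some 3],
    ![some 0, some 2, some 6], ![some 0, some 3, some 5], ![some 0, some 4, some 5],
    ![some 0, none, some 6], ![none, some 0, some 2]]

/-- The orbit under `Z_7` of an arc between two groups; the differences `0, 5, 6` are unused. -/
def arcClass : Option (Fin 7) → Option (Fin 7) → Option (Fin 6)
  | some a, some b =>
    (![none, some 0, some 1, some 2, some 3, none, none] : Fin 7 → Option (Fin 6)) (b - a)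
  | some _, none => some 4
  | none, some _ => some 5
  | none, none => none

/-- The orbit of the arc leaving position `r` of a starter triangle. -/
def starterClass : Fin 8 → Fin 3 → Fin 6 :=
  ![![0, 2, 2], ![0, 4, 5], ![1, 0, 3], ![1, 3, 0], ![2, 1, 1], ![3, 0, 1], ![4, 5, 0], ![5, 1, 4]]

/-- The difference along the arc leaving position `r` in the `x`-th copy of a starter triangle. -/
def diff (m : ℕ) (F : Fin 8) (r : Fin 3) (x : ℕ) : ZMod (2 * m) :=
  (![![-((2 * x : ℕ) : ZMod (2 * m)), (x : ℕ), (x : ℕ)],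
    ![-((2 * x + 1 : ℕ) : ZMod (2 * m)), (x : ℕ), (x + 1 : ℕ)],
    ![(m + 1 + x : ℕ), -((m + 2 + 2 * x : ℕ) : ZMod (2 * m)), (x + 1 : ℕ)],
    ![(x + 1 : ℕ), (x + 1 : ℕ), -((2 * x + 2 : ℕ) : ZMod (2 * m))],
    ![(x : ℕ), -((2 * x : ℕ) : ZMod (2 * m)), (x : ℕ)],
    ![(x + 1 : ℕ), -((m + 1 + 2 * x : ℕ) : ZMod (2 * m)), (m + x : ℕ)],
    ![(x : ℕ), (x + 1 : ℕ), -((2 * x + 1 : ℕ) : ZMod (2 * m))],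
    ![(x + 1 : ℕ), -((2 * x + 1 : ℕ) : ZMod (2 * m)), (x : ℕ)]] :
      Fin 8 → Fin 3 → ZMod (2 * m)) F r

/-- The differences which are used in the positive direction by the arcs of a given orbit. -/
def Allowed (m : ℕ) (c : Fin 6) (d : ZMod (2 * m)) : Prop :=
  (c = 2 ∨ c = 4 → ∃ x < m, d = (x : ℕ)) ∧ (c = 3 ∨ c = 5 → ∃ x < m, d = (x + 1 : ℕ))

theorem natCast_eq_cases {m a b : ℕ} (h : (a : ZMod (2 * m)) = b)
    (ha : a < b + 4 * m) (hb : b < a + 4 * m) : a = b ∨ a = b + 2 * m ∨ b = a + 2 * m := by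
  rw [← Int.cast_natCast a, ← Int.cast_natCast b, ZMod.intCast_eq_intCast_iff_dvd_sub] at h
  obtain ⟨k, hk⟩ := h
  push_cast at hk
  have h1 : k < 2 := by nlinarith
  have h2 : -2 < k := by nlinarith
  obtain rfl | rfl | rfl : k = -1 ∨ k = 0 ∨ k = 1 := by omega
  all_goals omega

theorem exists_natCast {m : ℕ} (hm : 0 < m) (d : ZMod (2 * m)) : ∃ n < 2 * m, d = (n : ℕ) := by
  have : NeZero (2 * m) := ⟨by omega⟩
  exact ⟨d.val, d.val_lt, by simp⟩

theorem diff_sum (m : ℕ) (F : Fin 8) (r : Fin 3) (x : ℕ) :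
    diff m F r x + diff m F (r + 1) x + diff m F (r + 2) x = 0 := by
  fin_cases F <;> fin_cases r <;> simp [diff] <;> ring

theorem diff_allowed {m x : ℕ} (hx : x < m) (F : Fin 8) (r : Fin 3) :
    Allowed m (starterClass F r) (diff m F r x) := by
  fin_cases F <;> fin_cases r <;> simp only [Allowed] <;>
    refine ⟨fun h => ?_, fun h => ?_⟩ <;>
    first
    | exact absurd h (by decide)
    | exact ⟨x, hx, rfl⟩

theorem diff_inj {m x y : ℕ} (hx : x < m) (hy : y < m) {F G : Fin 8} (r : Fin 3)
    (hc : starterClass F r = starterClass G r) (hd : diff m F r x = diff m G r y) :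
    F = G ∧ x = y := by
  have key : ∀ a b : ℕ, a < b + 4 * m → b < a + 4 * m → (a : ZMod (2 * m)) = b →
    a = b ∨ a = b + 2 * m ∨ b = a + 2 * m := fun a b ha hb h => natCast_eq_cases h ha hb
  fin_cases r <;> fin_cases F <;> fin_cases G <;>
    first
    | exact absurd hc (by decide)
    | (refine ⟨rfl, ?_⟩
       first
       | (have := key _ _ (by omega) (by omega) (neg_injective hd); omega)
       | (have := key _ _ (by omega) (by omega) hd; omega))
    | (exfalso
       first
       | (have := key _ _ (by omega) (by omega) (neg_injective hd); omega)
       | (have := key _ _ (by omega) (by omega) hd; omega))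

theorem interval_cases_add {m : ℕ} (hm : 0 < m) (b : ℕ) (d : ZMod (2 * m)) :
    (∃ x < m, d = (x + b : ℕ)) ∨ ∃ x < m, d = (m + x + b : ℕ) := by
  obtain ⟨n, hn, h⟩ := exists_natCast hm (d - b)
  rw [sub_eq_iff_eq_add] at h
  obtain h' | h' := lt_or_ge n m
  · exact .inl ⟨n, h', by rw [h]; push_cast; ring⟩
  · obtain ⟨x, rfl⟩ := Nat.exists_eq_add_of_le h'
    exact .inr ⟨x, by omega, by rw [h]; push_cast; ring⟩

theorem parity_cases_add {m : ℕ} (hm : 0 < m) (b : ℕ) (d : ZMod (2 * m)) :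
    (∃ x < m, d = -((2 * x + b : ℕ) : ZMod (2 * m))) ∨
      ∃ x < m, d = -((2 * x + 1 + b : ℕ) : ZMod (2 * m)) := by
  obtain ⟨n, hn, h⟩ := exists_natCast hm (-d - b)
  have h' : d = -((n + b : ℕ) : ZMod (2 * m)) := by push_cast; linear_combination -h
  obtain ⟨x, rfl | rfl⟩ := n.even_or_odd'
  · exact .inl ⟨x, by omega, h'⟩
  · exact .inr ⟨x, by omega, h'⟩

theorem exists_diff {m : ℕ} (hm : 0 < m) {c : Fin 6} {d : ZMod (2 * m)} (h : Allowed m c d)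
    (r : Fin 3) : ∃ F, ∃ x < m, starterClass F r = c ∧ diff m F r x = d := by
  have pair : ∀ F G, starterClass F r = c → starterClass G r = c →
      ((∃ x < m, d = diff m F r x) ∨ ∃ x < m, d = diff m G r x) →
      ∃ F, ∃ x < m, starterClass F r = c ∧ diff m F r x = d := by
    rintro F G hF hG (⟨x, hx, h⟩ | ⟨x, hx, h⟩)
    · exact ⟨F, x, hx, hF, h.symm⟩
    · exact ⟨G, x, hx, hG, h.symm⟩
  have single : ∀ F, starterClass F r = c → (∃ x < m, d = diff m F r x) →
      ∃ F, ∃ x < m, starterClass F r = c ∧ diff m F r x = d :=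
    fun F hF h => pair F F hF hF (.inl h)
  fin_cases c
  · fin_cases r
    · exact pair 0 1 rfl rfl (parity_cases_add hm 0 d)
    · refine pair 5 2 rfl rfl ((parity_cases_add hm (m + 1) d).imp ?_ ?_) <;>
        rintro ⟨x, hx, rfl⟩ <;> refine ⟨x, hx, ?_⟩ <;> simp [diff] <;> ring
    · exact pair 6 3 rfl rfl (parity_cases_add hm 1 d)
  · fin_cases r
    · refine pair 3 2 rfl rfl ((interval_cases_add hm 1 d).imp_right ?_)
      rintro ⟨x, hx, rfl⟩
      exact ⟨x, hx, by simp [diff]; ring⟩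
    · exact pair 4 7 rfl rfl (parity_cases_add hm 0 d)
    · exact pair 4 5 rfl rfl (interval_cases_add hm 0 d)
  · have h' := h.1 (by decide)
    fin_cases r
    exacts [single 4 rfl h', single 0 rfl h', single 0 rfl h']
  · have h' := h.2 (by decide)
    fin_cases r
    exacts [single 5 rfl h', single 3 rfl h', single 2 rfl h']
  · have h' := h.1 (by decide)
    fin_cases r
    exacts [single 6 rfl h', single 1 rfl h', single 7 rfl h']
  · have h' := h.2 (by decide)
    fin_cases r
    exacts [single 7 rfl h', single 6 rfl h', single 1 rfl h']

/-- The arcs oriented positively between points of different groups. -/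
def Arc (m : ℕ) (i j : Fin 8) (d : ZMod (2 * m)) : Prop :=
  ∃ c, arcClass (finSuccEquiv 7 i) (finSuccEquiv 7 j) = some c ∧ Allowed m c d

theorem Allowed.zero (m : ℕ) (d : ZMod (2 * m)) : Allowed m 0 d := by simp [Allowed]

theorem Allowed.one (m : ℕ) (d : ZMod (2 * m)) : Allowed m 1 d := by simp [Allowed]

theorem interval_or_neg {m : ℕ} (hm : 0 < m) (d : ZMod (2 * m)) :
    (∃ x < m, d = (x : ℕ)) ∨ ∃ x < m, -d = (x + 1 : ℕ) := by
  obtain ⟨n, hn, rfl⟩ := exists_natCast hm d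
  obtain h | h := lt_or_ge n m
  · exact .inl ⟨n, h, rfl⟩
  · refine .inr ⟨2 * m - 1 - n, by omega, ?_⟩
    rw [neg_eq_iff_add_eq_zero, ← Nat.cast_add,
      show n + (2 * m - 1 - n + 1) = 2 * m by omega, ZMod.natCast_self]

theorem not_interval_and_neg {m : ℕ} {d : ZMod (2 * m)} (h : ∃ x < m, d = (x : ℕ))
    (h' : ∃ x < m, -d = (x + 1 : ℕ)) : False := by
  obtain ⟨x, hx, rfl⟩ := h
  obtain ⟨y, hy, h⟩ := h'
  rw [neg_eq_iff_add_eq_zero, ← Nat.cast_add, ← Nat.cast_zero] at h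
  have := natCast_eq_cases h (by omega) (by omega)
  omega

theorem arcClass_cases : ∀ i j : Option (Fin 7), i ≠ j →
    (arcClass i j = some 0 ∧ arcClass j i = none) ∨ (arcClass i j = some 1 ∧ arcClass j i = none) ∨
    (arcClass i j = none ∧ arcClass j i = some 0) ∨ (arcClass i j = none ∧ arcClass j i = some 1) ∨
    (arcClass i j = some 2 ∧ arcClass j i = some 3) ∨
    (arcClass i j = some 3 ∧ arcClass j i = some 2) ∨
    (arcClass i j = some 4 ∧ arcClass j i = some 5) ∨
    (arcClass i j = some 5 ∧ arcClass j i = some 4) := by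
  decide

theorem arcClass_self (i : Option (Fin 7)) : arcClass i i = none := by
  revert i; decide

theorem Arc.ne {m : ℕ} {i j : Fin 8} {d : ZMod (2 * m)} (h : Arc m i j d) : i ≠ j := by
  rintro rfl
  obtain ⟨c, hc, -⟩ := h
  simp [arcClass_self] at hc

theorem Arc.asymm {m : ℕ} {i j : Fin 8} {d : ZMod (2 * m)} (h : Arc m i j d) :
    ¬ Arc m j i (-d) := by
  have hne := h.ne
  rintro ⟨c', hc', h'⟩
  obtain ⟨c, hc, h⟩ := h
  rcases arcClass_cases _ _ ((finSuccEquiv 7).injective.ne hne) with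
      H | H | H | H | H | H | H | H <;>
    simp only [H.1, H.2, Option.some.injEq, reduceCtorEq] at hc hc' <;> subst hc hc'
  · exact not_interval_and_neg (h.1 (by decide)) (h'.2 (by decide))
  · exact not_interval_and_neg (h'.1 (by decide)) (by simpa using h.2 (by decide))
  · exact not_interval_and_neg (h.1 (by decide)) (h'.2 (by decide))
  · exact not_interval_and_neg (h'.1 (by decide)) (by simpa using h.2 (by decide))

theorem arc_or_arc_neg {m : ℕ} (hm : 0 < m) {i j : Fin 8} (hij : i ≠ j) (d : ZMod (2 * m)) :
    Arc m i j d ∨ Arc m j i (-d) := by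
  have key : ∀ e : ZMod (2 * m), ∀ c c' : Fin 6, (c = 2 ∧ c' = 3) ∨ (c = 4 ∧ c' = 5) →
      Allowed m c e ∨ Allowed m c' (-e) := by
    rintro e c c' (⟨rfl, rfl⟩ | ⟨rfl, rfl⟩) <;> simpa [Allowed] using interval_or_neg hm e
  rcases arcClass_cases _ _ ((finSuccEquiv 7).injective.ne hij) with
      H | H | H | H | H | H | H | H
  · exact .inl ⟨0, H.1, .zero _ _⟩
  · exact .inl ⟨1, H.1, .one _ _⟩
  · exact .inr ⟨0, H.2, .zero _ _⟩
  · exact .inr ⟨1, H.2, .one _ _⟩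
  · exact (key d 2 3 (by decide)).imp (⟨_, H.1, ·⟩) (⟨_, H.2, ·⟩)
  · exact (key (-d) 2 3 (by decide)).symm.imp (fun h => ⟨_, H.1, by simpa using h⟩) (⟨_, H.2, ·⟩)
  · exact (key d 4 5 (by decide)).imp (⟨_, H.1, ·⟩) (⟨_, H.2, ·⟩)
  · exact (key (-d) 4 5 (by decide)).symm.imp (fun h => ⟨_, H.1, by simpa using h⟩) (⟨_, H.2, ·⟩)

theorem arcClass_vert : ∀ (F : Fin 8) (r : Fin 3) (a : Fin 7),
    arcClass ((vert F r).map (· + a)) ((vert F (r + 1)).map (· + a)) =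
      some (starterClass F r) := by
  decide

theorem exists_shift : ∀ (F : Fin 8) (r : Fin 3) (i j : Option (Fin 7)),
    arcClass i j = some (starterClass F r) →
      ∃ a, i = (vert F r).map (· + a) ∧ j = (vert F (r + 1)).map (· + a) := by
  decide

theorem shift_inj : ∀ (F : Fin 8) (r : Fin 3) (a b : Fin 7),
    (vert F r).map (· + a) = (vert F r).map (· + b) →
    (vert F (r + 1)).map (· + a) = (vert F (r + 1)).map (· + b) → a = b := by
  decide

/-- The triangle with vertices in the groups `i, j, k` and differences `d, e, f` is a copy of a
starter triangle read from position `r`. -/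
def Triangle (m : ℕ) (r : Fin 3) (i j k : Fin 8) (d e f : ZMod (2 * m)) : Prop :=
  ∃ F a, ∃ x < m, finSuccEquiv 7 i = (vert F r).map (· + a) ∧
    finSuccEquiv 7 j = (vert F (r + 1)).map (· + a) ∧
    finSuccEquiv 7 k = (vert F (r + 2)).map (· + a) ∧
    d = diff m F r x ∧ e = diff m F (r + 1) x ∧ f = diff m F (r + 2) x

theorem Triangle.rotate {m : ℕ} {r : Fin 3} {i j k : Fin 8} {d e f : ZMod (2 * m)}
    (h : Triangle m r i j k d e f) : Triangle m (r + 1) j k i e f d := by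
  obtain ⟨F, a, x, hx, hi, hj, hk, hd, he, hf⟩ := h
  have h1 : r + 1 + 1 = r + 2 := by rw [add_assoc]; rfl
  have h2 : r + 1 + 2 = r := by rw [add_assoc]; exact add_zero r
  exact ⟨F, a, x, hx, hj, h1 ▸ hk, h2.symm ▸ hi, he, h1 ▸ hf, h2.symm ▸ hd⟩

theorem Triangle.arc {m : ℕ} {r : Fin 3} {i j k : Fin 8} {d e f : ZMod (2 * m)}
    (h : Triangle m r i j k d e f) : Arc m i j d := by
  obtain ⟨F, a, x, hx, hi, hj, -, rfl, -⟩ := h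
  exact ⟨_, by rw [hi, hj, arcClass_vert], diff_allowed hx F r⟩

theorem Triangle.unique {m : ℕ} {r : Fin 3} {i j k k' : Fin 8} {d e f e' f' : ZMod (2 * m)}
    (h : Triangle m r i j k d e f) (h' : Triangle m r i j k' d e' f') : k = k' ∧ e = e' := by
  obtain ⟨F, a, x, hx, hi, hj, hk, hd, he, -⟩ := h
  obtain ⟨G, b, y, hy, hi', hj', hk', hd', he', -⟩ := h'
  have hc : starterClass F r = starterClass G r := by
    rw [← Option.some_inj, ← arcClass_vert F r a, ← arcClass_vert G r b, ← hi, ← hj, ← hi', ← hj']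
  obtain ⟨rfl, rfl⟩ := diff_inj hx hy r hc (hd.symm.trans hd')
  obtain rfl := shift_inj F r a b (hi.symm.trans hi') (hj.symm.trans hj')
  exact ⟨(finSuccEquiv 7).injective (hk.trans hk'.symm), he.trans he'.symm⟩

theorem Arc.exists_triangle {m : ℕ} (hm : 0 < m) {i j : Fin 8} {d : ZMod (2 * m)}
    (h : Arc m i j d) (r : Fin 3) : ∃ k e, Triangle m r i j k d e (-(d + e)) := by
  obtain ⟨c, hc, h⟩ := h
  obtain ⟨F, x, hx, rfl, rfl⟩ := exists_diff hm h r
  obtain ⟨a, hi, hj⟩ := exists_shift F r _ _ hc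
  exact ⟨(finSuccEquiv 7).symm ((vert F (r + 2)).map (· + a)), diff m F (r + 1) x, F, a, x, hx,
    hi, hj, by simp, rfl, rfl, by linear_combination -diff_sum m F r x⟩

/-- Position `0` of the cyclic triple with entries `a, b, c` in positions `r, r + 1, r + 2` holds
the minimal entry, ties being broken so that exactly one rotation of a non-constant triple
qualifies. -/
def Leads {v : ℕ} : Fin 3 → Fin v → Fin v → Fin v → Prop
  | 0, a, b, c => a ≤ b ∧ a < c
  | 1, a, b, c => c ≤ a ∧ c < b
  | 2, a, b, c => b ≤ c ∧ b < a

theorem Leads.rotate {v : ℕ} {r : Fin 3} {a b c : Fin v} (h : Leads r a b c) :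
    Leads (r + 1) b c a := by
  fin_cases r <;> exact h

theorem Leads.ne {v : ℕ} {r : Fin 3} {a : Fin v} : ¬ Leads r a a a := by
  fin_cases r <;> simp [Leads]

theorem exists_leads {v : ℕ} {a b c : Fin v} (h : ¬ (a = b ∧ b = c)) : ∃ r, Leads r a b c := by
  by_cases h0 : a ≤ b ∧ a < c
  · exact ⟨0, h0⟩
  by_cases h1 : c ≤ a ∧ c < b
  · exact ⟨1, h1⟩
  · exact ⟨2, show b ≤ c ∧ b < a by omega⟩

theorem Leads.unique {v : ℕ} {r s : Fin 3} {a b c : Fin v} (h : Leads r a b c)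
    (h' : Leads s a b c) : r = s := by
  fin_cases r <;> fin_cases s <;> simp only [Leads] at h h' <;> first | rfl | omega

theorem eq_zero_of_add_add_eq_zero {v : ℕ} [NeZero v] (hv : ¬ 3 ∣ v) {a : Fin v}
    (h : a + a + a = 0) : a = 0 := by
  rw [Fin.ext_iff, Fin.val_add, Fin.val_add, Fin.val_zero, Nat.mod_add_mod] at h
  obtain ⟨k, hk⟩ := Nat.dvd_of_mod_eq_zero h
  have ha := a.isLt
  have hk3 : k < 3 := by nlinarith
  rw [Fin.ext_iff, Fin.val_zero]
  interval_cases k <;> omega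

/-- The relation of being a block, listed along its positively oriented arcs. -/
def Block (m v : ℕ) [NeZero v] (p q s : Fin 8 × Fin v × ZMod (2 * m)) : Prop :=
  p.2.1 + q.2.1 + s.2.1 = 0 ∧ ∃ r, Leads r p.2.1 q.2.1 s.2.1 ∧
    Triangle m r p.1 q.1 s.1 (q.2.2 - p.2.2) (s.2.2 - q.2.2) (p.2.2 - s.2.2)

section Block

variable {m v : ℕ} [NeZero v] {p q s s' : Fin 8 × Fin v × ZMod (2 * m)}

theorem Block.rotate (h : Block m v p q s) : Block m v q s p := by
  obtain ⟨h0, r, hl, ht⟩ := h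
  exact ⟨by rw [← h0]; abel, r + 1, hl.rotate, ht.rotate⟩

theorem Block.arc (h : Block m v p q s) : Arc m p.1 q.1 (q.2.2 - p.2.2) := by
  obtain ⟨-, r, -, ht⟩ := h
  exact ht.arc

theorem Block.not_hole (h : Block m v p q s) : ¬ (p.2.1 = 0 ∧ q.2.1 = 0) := by
  rintro ⟨hp, hq⟩
  obtain ⟨h0, r, hl, -⟩ := h
  rw [hp, hq, zero_add, zero_add] at h0
  rw [hp, hq, h0] at hl
  exact hl.ne

theorem Block.unique (h : Block m v p q s) (h' : Block m v p q s') : s = s' := by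
  obtain ⟨h0, r, hl, ht⟩ := h
  obtain ⟨h0', r', hl', ht'⟩ := h'
  have hs : s.2.1 = s'.2.1 := add_left_cancel (h0.trans h0'.symm)
  rw [← hs] at hl'
  obtain rfl := hl.unique hl'
  obtain ⟨hk, he⟩ := ht.unique ht'
  exact Prod.ext hk (Prod.ext hs (sub_left_injective he))

theorem exists_block (hm : 0 < m) (hv : ¬ 3 ∣ v) (h : Arc m p.1 q.1 (q.2.2 - p.2.2))
    (h0 : ¬ (p.2.1 = 0 ∧ q.2.1 = 0)) : ∃ s, Block m v p q s := by
  obtain ⟨r, hr⟩ : ∃ r, Leads r p.2.1 q.2.1 (-(p.2.1 + q.2.1)) := by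
    refine exists_leads fun ⟨h1, h2⟩ => h0 ?_
    rw [← h1] at h2 ⊢
    have := eq_zero_of_add_add_eq_zero hv (a := p.2.1) (by
      nth_rw 3 [h2]
      exact add_neg_cancel _)
    exact ⟨this, this⟩
  obtain ⟨k, e, ht⟩ := h.exists_triangle hm r
  refine ⟨(k, -(p.2.1 + q.2.1), q.2.2 + e), add_neg_cancel _, r, hr, ?_⟩
  convert ht using 1
  · simp
  · ring

theorem Block.shift (h : Block m v p q s) :
    Block m v (p.1, p.2.1, p.2.2 + 1) (q.1, q.2.1, q.2.2 + 1) (s.1, s.2.1, s.2.2 + 1) := by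
  simpa [Block] using h

theorem Block.rotate_to (h : Block m v p q s) {x y : Fin 8 × Fin v × ZMod (2 * m)}
    (hx : x ∈ ({p, q, s} : Finset (Fin 8 × Fin v × ZMod (2 * m))))
    (hy : y ∈ ({p, q, s} : Finset (Fin 8 × Fin v × ZMod (2 * m)))) (hxy : x ≠ y) :
    ∃ z, ({p, q, s} : Finset (Fin 8 × Fin v × ZMod (2 * m))) = {x, y, z} ∧
      (Block m v x y z ∨ Block m v y x z) := by
  simp only [Finset.mem_insert, Finset.mem_singleton] at hx hy
  rcases hx with rfl | rfl | rfl <;> rcases hy with rfl | rfl | rfl <;>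
    first
    | exact absurd rfl hxy
    | exact ⟨_, by grind, .inl h⟩
    | exact ⟨_, by grind, .inl h.rotate⟩
    | exact ⟨_, by grind, .inl h.rotate.rotate⟩
    | exact ⟨_, by grind, .inr h⟩
    | exact ⟨_, by grind, .inr h.rotate⟩
    | exact ⟨_, by grind, .inr h.rotate.rotate⟩

theorem existsUnique_block (hm : 0 < m) (hv : ¬ 3 ∣ v) (h : Arc m p.1 q.1 (q.2.2 - p.2.2))
    (h0 : ¬ (p.2.1 = 0 ∧ q.2.1 = 0)) :
    ∃! B : Finset (Fin 8 × Fin v × ZMod (2 * m)),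
      (∃ x y z, Block m v x y z ∧ B = {x, y, z}) ∧ p ∈ B ∧ q ∈ B := by
  obtain ⟨s, hs⟩ := exists_block hm hv h h0
  refine ⟨{p, q, s}, ⟨⟨p, q, s, hs, rfl⟩, by simp, by simp⟩, ?_⟩
  rintro B ⟨⟨x, y, z, hb, rfl⟩, hp, hq⟩
  obtain ⟨t, hB, ht | ht⟩ := hb.rotate_to hp hq fun e => h.ne (congrArg Prod.fst e)
  · rw [hB, hs.unique ht]
  · exact absurd (by simpa using ht.arc) h.asymm

end Block

end CyclicIGDD

/-- Let v be a positive integer with v ≡ 1 or 2 (mod 3) and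
v ≥ 2. Then for every even positive integer w there exists a w-cyclic 3-IGDD
of type (vw,w)^8. -/
theorem exists_cyclic_igdd_vw_w_8
    (v w : ℕ) (hv : v % 3 = 1 ∨ v % 3 = 2) (hv2 : 2 ≤ v)
    (hw : 0 < w) (heven : w % 2 = 0) :
    ∃ ℬ : Finset (Finset (Fin 8 × Fin v × ZMod w)),
      IsCyclicIGDDrow 8 v w 1 ℬ := by
  classical
  obtain ⟨m, rfl⟩ : ∃ m, w = 2 * m := ⟨w / 2, by omega⟩
  have hm : 0 < m := by omega
  have : NeZero v := ⟨by omega⟩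
  have : NeZero (2 * m) := ⟨by omega⟩
  have hv3 : ¬ 3 ∣ v := by omega
  have lt_one : ∀ a : Fin v, (a : ℕ) < 1 ↔ a = 0 := fun a => by
    rw [Nat.lt_one_iff, Fin.ext_iff, Fin.val_zero]
  refine ⟨Finset.univ.filter fun B => ∃ x y z, CyclicIGDD.Block m v x y z ∧ B = {x, y, z},
    ?_, ?_, ?_, ?_⟩ <;> simp only [Finset.mem_filter, Finset.mem_univ, true_and, lt_one]
  · rintro B ⟨x, y, z, h, rfl⟩
    refine Finset.card_eq_three.2 ⟨x, y, z, ?_, ?_, ?_, rfl⟩ <;> rintro rfl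
    exacts [h.arc.ne rfl, h.rotate.rotate.arc.ne rfl, h.rotate.arc.ne rfl]
  · rintro B ⟨x, y, z, h, rfl⟩ p hp q hq hpq
    obtain ⟨s, -, hs | hs⟩ := h.rotate_to hp hq hpq
    · exact ⟨hs.arc.ne, hs.not_hole⟩
    · exact ⟨hs.arc.ne.symm, fun e => hs.not_hole e.symm⟩
  · intro p q hpq h0
    rcases CyclicIGDD.arc_or_arc_neg hm hpq (q.2.2 - p.2.2) with h | h
    · exact CyclicIGDD.existsUnique_block hm hv3 h h0
    · rw [neg_sub] at h
      simpa only [and_comm (a := p ∈ _)] using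
        CyclicIGDD.existsUnique_block hm hv3 h fun e => h0 e.symm
  · rintro B ⟨x, y, z, h, rfl⟩
    exact ⟨_, _, _, h.shift, by simp [Finset.image_insert]⟩
end

section
/- Let u ≡ 2 (mod 6) with u ≥ 8, and let v be a positive integer with v ≡ 1 or 2 (mod 3) and v ≥ 2. Then there exists a 4-cyclic 3-IGDD of type (4v,4)^u. -/
/-- A totally symmetric ternary relation `T` is a decomposition of the graph `E` into triangles:
every edge of `E` lies in exactly one triangle, and all sides of the triangles are edges. -/
structure IsTriangulation {X : Type*} (E : X → X → Prop) (T : X → X → X → Prop) : Prop where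
  swap : ∀ {a b c}, T a b c → T b a c
  rot : ∀ {a b c}, T a b c → T b c a
  edge : ∀ {a b c}, T a b c → E a b
  exists_third : ∀ {a b}, E a b → ∃ c, T a b c
  unique : ∀ {a b c d}, T a b c → T a b d → c = d

/-- The graph `E` has a decomposition into triangles. -/
def HasTriangulation {X : Type*} (E : X → X → Prop) : Prop := ∃ T, IsTriangulation E T

/-- The lift of the graph `E` to `V × ZMod 4`, in which every edge is replaced by all edges
between the two fibres, has a decomposition into triangles invariant under translation. -/
def HasCyclicLift {V : Type*} (E : V → V → Prop) : Prop :=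
  ∃ T : V × ZMod 4 → V × ZMod 4 → V × ZMod 4 → Prop,
    IsTriangulation (fun p q => E p.1 q.1) T ∧
    ∀ {p q r}, T p q r → T (p.1, p.2 + 1) (q.1, q.2 + 1) (r.1, r.2 + 1)

/-- The tensor product of two graphs (loops allowed). -/
def prodRel {A B : Type*} (E : A → A → Prop) (F : B → B → Prop) (p q : A × B) : Prop :=
  E p.1 q.1 ∧ F p.2 q.2

/-- The complete graph with a loop at every vertex except `z`. -/
def offHole {A : Type*} (z : A) (a b : A) : Prop := ¬(a = z ∧ b = z)

theorem IsTriangulation.of_equiv {X Y : Type*} {E : X → X → Prop} {F : Y → Y → Prop}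
    {T : X → X → X → Prop} (h : IsTriangulation E T) (e : Y ≃ X)
    (hF : ∀ a b, F a b ↔ E (e a) (e b)) :
    IsTriangulation F (fun a b c => T (e a) (e b) (e c)) where
  swap := h.swap
  rot := h.rot
  edge t := (hF _ _).2 (h.edge t)
  exists_third {a b} hab := by
    obtain ⟨c, hc⟩ := h.exists_third ((hF a b).1 hab)
    exact ⟨e.symm c, by simpa using hc⟩
  unique t t' := e.injective (h.unique t t')

theorem IsTriangulation.ne {X : Type*} {E : X → X → Prop} {T : X → X → X → Prop}
    (hT : IsTriangulation E T) (hirr : ∀ a, ¬E a a) {a b c : X} (t : T a b c) : a ≠ b := by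
  rintro rfl
  exact hirr _ (hT.edge t)

theorem IsTriangulation.card_eq_three {X : Type*} [DecidableEq X] {E : X → X → Prop}
    {T : X → X → X → Prop} (hT : IsTriangulation E T) (hirr : ∀ a, ¬E a a) {a b c : X}
    (t : T a b c) : ({a, b, c} : Finset X).card = 3 :=
  Finset.card_eq_three.2 ⟨a, b, c, hT.ne hirr t, (hT.ne hirr (hT.rot (hT.rot t))).symm,
    hT.ne hirr (hT.rot t), rfl⟩

/-- A triangle can be listed starting from any two of its points. -/
theorem IsTriangulation.exists_of_mem {X : Type*} [DecidableEq X] {E : X → X → Prop}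
    {T : X → X → X → Prop} (hT : IsTriangulation E T) {a b c x y : X} (t : T a b c)
    (hx : x ∈ ({a, b, c} : Finset X)) (hy : y ∈ ({a, b, c} : Finset X)) (hxy : x ≠ y) :
    ∃ z, T x y z ∧ ({a, b, c} : Finset X) = {x, y, z} := by
  have t1 := hT.rot t
  have t2 := hT.rot t1
  simp only [Finset.mem_insert, Finset.mem_singleton] at hx hy
  rcases hx with rfl | rfl | rfl <;> rcases hy with rfl | rfl | rfl
  · exact absurd rfl hxy
  · exact ⟨_, t, rfl⟩
  · exact ⟨_, hT.swap t2, by ext; simp; tauto⟩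
  · exact ⟨_, hT.swap t, by ext; simp; tauto⟩
  · exact absurd rfl hxy
  · exact ⟨_, t1, by ext; simp; tauto⟩
  · exact ⟨_, t2, by ext; simp; tauto⟩
  · exact ⟨_, hT.swap t1, by ext; simp; tauto⟩
  · exact absurd rfl hxy

theorem HasTriangulation.of_equiv {X Y : Type*} {E : X → X → Prop} {F : Y → Y → Prop}
    (h : HasTriangulation E) (e : Y ≃ X) (hF : ∀ a b, F a b ↔ E (e a) (e b)) :
    HasTriangulation F :=
  let ⟨_, hT⟩ := h
  ⟨_, hT.of_equiv e hF⟩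

namespace HasCyclicLift

theorem of_equiv {V W : Type*} {E : V → V → Prop} {F : W → W → Prop} (h : HasCyclicLift E)
    (e : W ≃ V) (hF : ∀ a b, F a b ↔ E (e a) (e b)) : HasCyclicLift F := by
  obtain ⟨T, hT, hs⟩ := h
  exact ⟨_, hT.of_equiv (e.prodCongr (Equiv.refl _)) (fun a b => hF a.1 b.1), fun t => hs t⟩

/-- Edge-disjoint unions of graphs with a cyclic lift have a cyclic lift. -/
theorem iUnion {V ι : Type*} {E : V → V → Prop} (F : ι → V → V → Prop)
    (h : ∀ i, HasCyclicLift (F i)) (hE : ∀ a b, E a b ↔ ∃ i, F i a b)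
    (hd : ∀ i j a b, F i a b → F j a b → i = j) : HasCyclicLift E := by
  choose T hT hs using h
  refine ⟨fun p q r => ∃ i, T i p q r, ?_, fun ⟨i, t⟩ => ⟨i, hs i t⟩⟩
  refine ⟨fun ⟨i, t⟩ => ⟨i, (hT i).swap t⟩, fun ⟨i, t⟩ => ⟨i, (hT i).rot t⟩,
    fun ⟨i, t⟩ => (hE _ _).2 ⟨i, (hT i).edge t⟩, fun {a b} hab => ?_, ?_⟩
  · obtain ⟨i, hi⟩ := (hE _ _).1 hab
    obtain ⟨c, hc⟩ := (hT i).exists_third (a := a) (b := b) hi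
    exact ⟨c, i, hc⟩
  · rintro a b c c' ⟨i, t⟩ ⟨j, t'⟩
    obtain rfl := hd i j _ _ ((hT i).edge t) ((hT j).edge t')
    exact (hT i).unique t t'

theorem map {V W : Type*} {E : V → V → Prop} {F : W → W → Prop} (h : HasCyclicLift E)
    {φ : V → W} (hφ : φ.Injective)
    (hF : ∀ a b, F a b ↔ ∃ x y, E x y ∧ φ x = a ∧ φ y = b) : HasCyclicLift F := by
  obtain ⟨T, hT, hs⟩ := h
  let ψ : V × ZMod 4 → W × ZMod 4 := Prod.map φ id
  have hψ : ψ.Injective := hφ.prodMap Function.injective_id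
  refine ⟨fun p q r => ∃ x y z, T x y z ∧ ψ x = p ∧ ψ y = q ∧ ψ z = r, ?_, ?_⟩
  · refine ⟨?_, ?_, ?_, ?_, ?_⟩
    · rintro _ _ _ ⟨x, y, z, t, rfl, rfl, rfl⟩
      exact ⟨y, x, z, hT.swap t, rfl, rfl, rfl⟩
    · rintro _ _ _ ⟨x, y, z, t, rfl, rfl, rfl⟩
      exact ⟨y, z, x, hT.rot t, rfl, rfl, rfl⟩
    · rintro _ _ _ ⟨x, y, z, t, rfl, rfl, rfl⟩
      exact (hF _ _).2 ⟨x.1, y.1, hT.edge t, rfl, rfl⟩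
    · rintro ⟨a, s⟩ ⟨b, s'⟩ hab
      obtain ⟨x, y, hxy, rfl, rfl⟩ := (hF _ _).1 hab
      obtain ⟨z, hz⟩ := hT.exists_third (a := (x, s)) (b := (y, s')) hxy
      exact ⟨ψ z, _, _, z, hz, rfl, rfl, rfl⟩
    · rintro _ _ _ _ ⟨x, y, z, t, rfl, rfl, rfl⟩ ⟨x', y', z', t', hx, hy, rfl⟩
      obtain rfl := hψ hx
      obtain rfl := hψ hy
      rw [hT.unique t t']
  · rintro _ _ _ ⟨x, y, z, t, rfl, rfl, rfl⟩
    exact ⟨_, _, _, hs t, rfl, rfl, rfl⟩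

theorem prod_comm {A B : Type*} {E : A → A → Prop} {F : B → B → Prop}
    (h : HasCyclicLift (prodRel E F)) : HasCyclicLift (prodRel F E) :=
  h.of_equiv (Equiv.prodComm B A) fun _ _ => and_comm

/-- Every vertex may be replaced by `|W|` twins. -/
theorem inflate {V : Type*} (W : Type*) [AddCommGroup W] {E : V → V → Prop}
    (h : HasCyclicLift E) : HasCyclicLift (prodRel E fun _ _ : W => True) := by
  obtain ⟨T, hT, hs⟩ := h
  refine ⟨fun p q r => T (p.1.1, p.2) (q.1.1, q.2) (r.1.1, r.2) ∧ p.1.2 + q.1.2 + r.1.2 = 0,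
    ⟨?_, ?_, ?_, ?_, ?_⟩, fun ⟨t, hw⟩ => ⟨hs t, hw⟩⟩
  · rintro a b c ⟨t, hw⟩
    exact ⟨hT.swap t, by rw [← hw]; abel⟩
  · rintro a b c ⟨t, hw⟩
    exact ⟨hT.rot t, by rw [← hw]; abel⟩
  · rintro a b c ⟨t, -⟩
    exact ⟨hT.edge t, trivial⟩
  · rintro ⟨⟨a, w⟩, s⟩ ⟨⟨b, w'⟩, s'⟩ ⟨hab, -⟩
    obtain ⟨⟨c, s''⟩, hc⟩ := hT.exists_third (a := (a, s)) (b := (b, s')) hab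
    exact ⟨((c, -(w + w')), s''), hc, by simp⟩
  · rintro ⟨⟨a, w⟩, s⟩ ⟨⟨b, w'⟩, s'⟩ ⟨⟨c, v⟩, r⟩ ⟨⟨c', v'⟩, r'⟩ ⟨t, hw⟩ ⟨t', hw'⟩
    have h1 := hT.unique t t'
    have h2 : v = v' := add_left_cancel (hw.trans hw'.symm)
    simp only [Prod.mk.injEq] at h1 ⊢
    exact ⟨⟨h1.1, h2⟩, h1.2⟩

/-- Edge-disjoint unions in the first factor of a tensor product. -/
theorem prod_iUnion {A B ι : Type*} {Γ : B → B → Prop} {E : A → A → Prop} (F : ι → A → A → Prop)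
    (h : ∀ i, HasCyclicLift (prodRel (F i) Γ)) (hE : ∀ a b, E a b ↔ ∃ i, F i a b)
    (hd : ∀ i j a b, F i a b → F j a b → i = j) : HasCyclicLift (prodRel E Γ) :=
  iUnion (fun i => prodRel (F i) Γ) h
    (fun a b => by simp only [prodRel, hE, exists_and_right])
    (fun i j a b hi hj => hd i j a.1 b.1 hi.1 hj.1)

theorem prod_map {A A' B : Type*} {Γ : B → B → Prop} {E : A → A → Prop} {F : A' → A' → Prop}
    (h : HasCyclicLift (prodRel E Γ)) {φ : A → A'} (hφ : φ.Injective)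
    (hF : ∀ a b, F a b ↔ ∃ x y, E x y ∧ φ x = a ∧ φ y = b) : HasCyclicLift (prodRel F Γ) := by
  refine h.map (hφ.prodMap Function.injective_id) fun a b => ⟨?_, ?_⟩
  · rintro ⟨hab, hΓ⟩
    obtain ⟨x, y, hxy, hx, hy⟩ := (hF _ _).1 hab
    exact ⟨(x, a.2), (y, b.2), ⟨hxy, hΓ⟩, Prod.ext hx rfl, Prod.ext hy rfl⟩
  · rintro ⟨x, y, ⟨hxy, hΓ⟩, rfl, rfl⟩
    exact ⟨(hF _ _).2 ⟨_, _, hxy, rfl, rfl⟩, hΓ⟩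

theorem prod_of_equiv {A A' B : Type*} {Γ : B → B → Prop} {E : A → A → Prop} {F : A' → A' → Prop}
    (h : HasCyclicLift (prodRel E Γ)) (e : A' ≃ A) (hF : ∀ a b, F a b ↔ E (e a) (e b)) :
    HasCyclicLift (prodRel F Γ) :=
  h.of_equiv (e.prodCongr (Equiv.refl B)) fun a b => and_congr (hF a.1 b.1) Iff.rfl

theorem prod_complete_of_card {A A' B : Type*} [Finite A] [Finite A'] {Γ : B → B → Prop}
    (h : HasCyclicLift (prodRel (fun a b : A => a ≠ b) Γ)) (hc : Nat.card A' = Nat.card A) :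
    HasCyclicLift (prodRel (fun a b : A' => a ≠ b) Γ) :=
  let ⟨e⟩ := Finite.card_eq.1 hc
  h.prod_of_equiv e fun a b => by simp

/-- A graph that decomposes into triangles inherits a cyclic lift from the triangle. -/
theorem prod_of_hasTriangulation {A B : Type*} {Γ : B → B → Prop} {E : A → A → Prop}
    (hE : HasTriangulation E) (hirr : ∀ a, ¬E a a)
    (h : HasCyclicLift (prodRel (fun a b : Fin 3 => a ≠ b) Γ)) :
    HasCyclicLift (prodRel E Γ) := by
  classical
  obtain ⟨T, hT⟩ := hE
  let ι := {S : Finset A // ∃ a b c, T a b c ∧ S = {a, b, c}}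
  refine prod_iUnion (fun (S : ι) a b => a ∈ S.1 ∧ b ∈ S.1 ∧ a ≠ b) ?_ ?_ ?_
  · rintro ⟨_, a, b, c, t, rfl⟩
    have hcard : Nat.card ({a, b, c} : Finset A) = Nat.card (Fin 3) := by
      simp only [Nat.card_eq_fintype_card, Fintype.card_coe, hT.card_eq_three hirr t,
        Fintype.card_fin]
    refine (h.prod_complete_of_card hcard).prod_map Subtype.val_injective fun x y => ?_
    constructor
    · rintro ⟨hx, hy, hxy⟩
      exact ⟨⟨x, hx⟩, ⟨y, hy⟩, fun h => hxy (congrArg Subtype.val h), rfl, rfl⟩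
    · rintro ⟨x, y, hxy, rfl, rfl⟩
      exact ⟨x.2, y.2, fun h => hxy (Subtype.ext h)⟩
  · refine fun a b => ⟨fun hab => ?_, ?_⟩
    · obtain ⟨c, t⟩ := hT.exists_third hab
      exact ⟨⟨_, a, b, c, t, rfl⟩, by simp, by simp, hT.ne hirr t⟩
    · rintro ⟨⟨_, a', b', c', t, rfl⟩, ha, hb, hab⟩
      obtain ⟨z, tz, -⟩ := hT.exists_of_mem t ha hb hab
      exact hT.edge tz
  · rintro ⟨_, a₁, b₁, c₁, t₁, rfl⟩ ⟨_, a₂, b₂, c₂, t₂, rfl⟩ a b ⟨ha, hb, hab⟩ ⟨ha', hb', -⟩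
    obtain ⟨z, tz, hz⟩ := hT.exists_of_mem t₁ ha hb hab
    obtain ⟨z', tz', hz'⟩ := hT.exists_of_mem t₂ ha' hb' hab
    obtain rfl := hT.unique tz tz'
    exact Subtype.ext (hz.trans hz'.symm)

end HasCyclicLift

/-- The graph on `H × ZMod 3` triangulated by the Bose–Skolem construction with the commutative
quasigroup `x * y = ρ⁻¹ (x + y)`. -/
def boseRel {H : Type*} [AddCommGroup H] (ρ : H → H) (a b : H × ZMod 3) : Prop :=
  (a.2 = b.2 ∧ a.1 ≠ b.1) ∨ (b.2 = a.2 + 1 ∧ ρ b.1 ≠ a.1 + a.1) ∨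
    (a.2 = b.2 + 1 ∧ ρ a.1 ≠ b.1 + b.1)

theorem hasTriangulation_boseRel {H : Type*} [AddCommGroup H] (ρ : H ≃ H) :
    HasTriangulation (boseRel ρ) := by
  let R (a b c : H × ZMod 3) : Prop :=
    a.2 = b.2 ∧ c.2 = a.2 + 1 ∧ a.1 ≠ b.1 ∧ ρ c.1 = a.1 + b.1
  have hR {a b c} (h : R a b c) : R b a c :=
    ⟨h.1.symm, h.1 ▸ h.2.1, h.2.2.1.symm, h.2.2.2.trans (add_comm _ _)⟩
  have z1 : ∀ i j : ZMod 3, i = j → j ≠ i + 1 := by decide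
  have z2 : ∀ i j : ZMod 3, j = i + 1 → i ≠ j + 1 := by decide
  refine ⟨fun a b c => R a b c ∨ R b c a ∨ R c a b, ⟨?_, ?_, ?_, ?_, ?_⟩⟩
  · rintro a b c (h | h | h)
    · exact Or.inl (hR h)
    · exact Or.inr (Or.inr (hR h))
    · exact Or.inr (Or.inl (hR h))
  · rintro a b c (h | h | h)
    · exact Or.inr (Or.inr h)
    · exact Or.inl h
    · exact Or.inr (Or.inl h)
  · rintro a b c (⟨h1, h2, h3, h4⟩ | ⟨h1, h2, h3, h4⟩ | ⟨h1, h2, h3, h4⟩)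
    · exact Or.inl ⟨h1, h3⟩
    · exact Or.inr (Or.inr ⟨h2, fun h => h3 (add_left_cancel (h.symm.trans h4))⟩)
    · exact Or.inr (Or.inl ⟨h1 ▸ h2, fun h => h3 (add_right_cancel (h4.symm.trans h))⟩)
  · rintro a b (⟨h1, h2⟩ | ⟨h1, h2⟩ | ⟨h1, h2⟩)
    · exact ⟨(ρ.symm (a.1 + b.1), a.2 + 1), Or.inl ⟨h1, rfl, h2, by simp⟩⟩
    · refine ⟨(ρ b.1 - a.1, a.2), Or.inr (Or.inr ⟨rfl, h1, fun h => h2 ?_, by simp⟩)⟩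
      exact sub_eq_iff_eq_add.1 h
    · refine ⟨(ρ a.1 - b.1, b.2), Or.inr (Or.inl ⟨rfl, h1, fun h => h2 ?_, by simp⟩)⟩
      exact sub_eq_iff_eq_add.1 h.symm
  · rintro a b c c' (⟨h1, h2, h3, h4⟩ | ⟨h1, h2, h3, h4⟩ | ⟨h1, h2, h3, h4⟩)
      (⟨k1, k2, k3, k4⟩ | ⟨k1, k2, k3, k4⟩ | ⟨k1, k2, k3, k4⟩)
    · exact Prod.ext (ρ.injective (h4.trans k4.symm)) (h2.trans k2.symm)
    · exact absurd k2 (z1 _ _ h1.symm)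
    · exact absurd (k1 ▸ k2) (z1 _ _ h1)
    · exact absurd h2 (z1 _ _ k1.symm)
    · exact Prod.ext (add_left_cancel (h4.symm.trans k4)) (h1.symm.trans k1)
    · exact absurd h2 (z2 _ _ (k1 ▸ k2))
    · exact absurd (h1 ▸ h2) (z1 _ _ k1)
    · exact absurd k2 (z2 _ _ (h1 ▸ h2))
    · exact Prod.ext (add_right_cancel (h4.symm.trans k4)) (h1.trans k1.symm)

/-- A 3-GDD of type `3 ^ (2 k + 1)`. -/
theorem hasTriangulation_type_three (k : ℕ) :
    HasTriangulation fun a b : ZMod (2 * k + 1) × Fin 3 => a.1 ≠ b.1 := by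
  have hinj : Function.Injective fun x : ZMod (2 * k + 1) => x + x := by
    intro x y h
    have h2 : IsUnit ((2 : ℕ) : ZMod (2 * k + 1)) :=
      (ZMod.isUnit_iff_coprime 2 (2 * k + 1)).2 (by simp)
    refine h2.mul_left_cancel ?_
    simpa only [Nat.cast_ofNat, two_mul (α := ZMod (2 * k + 1))] using h
  refine (hasTriangulation_boseRel (Equiv.ofBijective _ hinj.bijective_of_finite)).of_equiv
    (Equiv.refl (ZMod (2 * k + 1) × ZMod 3)) fun a b => ?_
  have z : ∀ i j : ZMod 3, i = j ∨ j = i + 1 ∨ i = j + 1 := by decide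
  have hinj' : ∀ x y : ZMod (2 * k + 1), x + x = y + y ↔ x = y := fun x y => hinj.eq_iff
  simp only [boseRel, Equiv.ofBijective_apply, ne_eq, hinj']
  have := z a.2 b.2
  have := @eq_comm _ a.1 b.1
  tauto

/-- A 3-GDD of type `2 ^ (3 k)`. -/
theorem hasTriangulation_type_two (k : ℕ) [NeZero k] :
    HasTriangulation fun a b : (Fin k × ZMod 3) × Fin 2 => a.1 ≠ b.1 := by
  have hk : 0 < k := Nat.pos_of_ne_zero (NeZero.ne k)
  have : NeZero (2 * k) := ⟨by omega⟩
  let ρ' : Fin (2 * k) → Fin (2 * k) := fun z =>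
    if h : z.1 < k then ⟨2 * z.1, by omega⟩ else ⟨2 * z.1 + 1 - 2 * k, by omega⟩
  have hρ' (z : Fin (2 * k)) : (ρ' z).1 = if z.1 < k then 2 * z.1 else 2 * z.1 + 1 - 2 * k := by
    simp only [ρ']
    split_ifs <;> rfl
  have hinj : ρ'.Injective := by
    intro x y h
    have h1 := congrArg Fin.val h
    rw [hρ', hρ'] at h1
    ext
    split_ifs at h1 <;> omega
  let ρ := Equiv.ofBijective ρ' hinj.bijective_of_finite
  have hdouble (x z : Fin (2 * k)) : ρ z = x + x ↔ z.1 < k ∧ (x.1 = z.1 ∨ x.1 = z.1 + k) := by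
    have hx := x.2
    have hz := z.2
    rw [Fin.ext_iff, Fin.val_add, Equiv.ofBijective_apply, hρ']
    rcases lt_or_ge (x.1 + x.1) (2 * k) with h | h
    · rw [Nat.mod_eq_of_lt h]
      split_ifs <;> omega
    · rw [Nat.mod_eq_sub_mod h, Nat.mod_eq_of_lt (by omega)]
      split_ifs <;> omega
  let E (a b : Fin (2 * k) × ZMod 3) : Prop :=
    boseRel ρ a b ∨ (a.1 = b.1 ∧ a.1.1 < k ∧ a.2 ≠ b.2)
  have hE : HasTriangulation E := by
    obtain ⟨T, hT⟩ := hasTriangulation_boseRel ρ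
    have z : ∀ i j : ZMod 3, i ≠ j → ∃ l, j ≠ l ∧ i ≠ l := by decide
    have z' : ∀ i j l l' : ZMod 3, i ≠ j → j ≠ l → i ≠ l → j ≠ l' → i ≠ l' → l = l' := by decide
    have hdisj {a b : Fin (2 * k) × ZMod 3} (h : boseRel ρ a b) (h1 : a.1 = b.1)
        (h2 : a.1.1 < k) (h3 : a.2 ≠ b.2) : False := by
      rcases h with h | h | h
      · exact h3 h.1
      · exact h.2 ((hdouble _ _).2 ⟨h1 ▸ h2, Or.inl (congrArg Fin.val h1)⟩)
      · exact h.2 ((hdouble _ _).2 ⟨h2, Or.inl (congrArg Fin.val h1.symm)⟩)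
    refine ⟨fun a b c => T a b c ∨
      (a.1 = b.1 ∧ b.1 = c.1 ∧ a.1.1 < k ∧ a.2 ≠ b.2 ∧ b.2 ≠ c.2 ∧ a.2 ≠ c.2),
      ⟨?_, ?_, ?_, ?_, ?_⟩⟩
    · rintro a b c (t | ⟨h1, h2, h3, h4, h5, h6⟩)
      · exact Or.inl (hT.swap t)
      · exact Or.inr ⟨h1.symm, h1.trans h2, h1 ▸ h3, h4.symm, h6, h5⟩
    · rintro a b c (t | ⟨h1, h2, h3, h4, h5, h6⟩)
      · exact Or.inl (hT.rot t)
      · exact Or.inr ⟨h2, (h1.trans h2).symm, h1 ▸ h3, h5, h6.symm, h4.symm⟩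
    · rintro a b c (t | ⟨h1, h2, h3, h4, h5, h6⟩)
      · exact Or.inl (hT.edge t)
      · exact Or.inr ⟨h1, h3, h4⟩
    · rintro a b (h | ⟨h1, h2, h3⟩)
      · obtain ⟨c, hc⟩ := hT.exists_third h
        exact ⟨c, Or.inl hc⟩
      · obtain ⟨l, hl⟩ := z _ _ h3
        exact ⟨(b.1, l), Or.inr ⟨h1, rfl, h2, h3, hl⟩⟩
    · rintro a b c c' (t | ⟨h1, h2, h3, h4, h5, h6⟩) (t' | ⟨k1, k2, k3, k4, k5, k6⟩)
      · exact hT.unique t t'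
      · exact (hdisj (hT.edge t) k1 k3 k4).elim
      · exact (hdisj (hT.edge t') h1 h3 h4).elim
      · exact Prod.ext (h2.symm.trans k2) (z' _ _ _ _ h4 h5 h6 k5 k6)
  let β (p : (Fin k × ZMod 3) × Fin 2) : Fin (2 * k) × ZMod 3 :=
    if p.2 = 0 then (⟨p.1.1, by have := p.1.1.2; omega⟩, p.1.2 + 1)
    else (⟨p.1.1 + k, by have := p.1.1.2; omega⟩, p.1.2)
  have hβ : β.Injective := by
    rintro ⟨⟨t, i⟩, ε⟩ ⟨⟨s, j⟩, δ⟩ h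
    have ht := t.2
    have hs := s.2
    fin_cases ε <;> fin_cases δ <;>
      simp only [β, Prod.mk.injEq, Fin.mk.injEq, Fin.zero_eta, Fin.mk_one, if_true, if_false,
        Fin.one_eq_zero_iff, add_left_inj, Nat.succ_ne_self] at h
    · simp [Fin.ext h.1, h.2]
    · omega
    · omega
    · simp [Fin.ext h.1, h.2]
  refine hE.of_equiv (Equiv.ofBijective β ((Fintype.bijective_iff_injective_and_card β).2
    ⟨hβ, by simp [ZMod.card]; ring⟩)) ?_
  rintro ⟨⟨t, i⟩, ε⟩ ⟨⟨s, j⟩, δ⟩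
  have ht := t.2
  have hs := s.2
  have h1 : t.1 ≠ s.1 + k := by omega
  have h2 : s.1 ≠ t.1 + k := by omega
  simp only [Equiv.ofBijective_apply, E, boseRel]
  have hd (x z : Fin (2 * k)) : ρ z ≠ x + x ↔ ¬(z.1 < k ∧ (x.1 = z.1 ∨ x.1 = z.1 + k)) :=
    (hdouble x z).not
  simp only [hd]
  by_cases hts : t = s
  · subst hts
    have h5 : t.1 ≠ t.1 + k + k := by omega
    fin_cases ε <;> fin_cases δ <;> simp [β, hk.ne', h5] <;> revert i j <;> decide
  · have hts' : t.1 ≠ s.1 := fun h => hts (Fin.ext h)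
    have hts'' : s.1 ≠ t.1 := hts'.symm
    fin_cases ε <;> fin_cases δ <;>
      simp [β, h1, h2, h1.symm, h2.symm, hts, hts', hts''] <;>
      revert i j <;> decide

/-- The tuple `(p, q, d, r, e)` stands for the orbit under translation of the triangle with
vertices `(p, 0)`, `(q, d)` and `(r, e)`. -/
abbrev BaseBlock : Type := ℕ × ℕ × ℕ × ℕ × ℕ

namespace BaseBlock

/-- The six base blocks representing the same triangle, one for each order of the vertices. -/
def orders : BaseBlock → List BaseBlock
  | (p, q, d, r, e) =>
    [(p, q, d, r, e), (p, r, e, q, d), (q, p, 3 * d, r, e + 3 * d), (q, r, e + 3 * d, p, 3 * d),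
      (r, p, 3 * e, q, d + 3 * e), (r, q, d + 3 * e, p, 3 * e)]

/-- The number encoding the first side of a base block on `n` points. -/
def key (n : ℕ) : BaseBlock → ℕ
  | (p, q, d, _, _) => (p * n + q) * 4 + d % 4

/-- The image of a base block under a map of the points. -/
def map (f : ℕ → ℕ) : BaseBlock → BaseBlock
  | (p, q, d, r, e) => (f p, f q, d, f r, e)

/-- The triangles obtained by translating the base block. -/
def Mem {n : ℕ} (P Q R : Fin n × ZMod 4) : BaseBlock → Prop
  | (p, q, d, r, e) => P.1 = p ∧ Q.1 = q ∧ R.1 = r ∧ Q.2 = P.2 + d ∧ R.2 = P.2 + e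

/-- All vertices are less than `n`. -/
def inRange (n : ℕ) : BaseBlock → Bool
  | (p, q, _, r, _) => p < n && q < n && r < n

theorem Mem.swap {n : ℕ} {P Q R : Fin n × ZMod 4} {s t : BaseBlock} (hs : s ∈ t.orders)
    (h : s.Mem P Q R) : ∃ s' ∈ t.orders, s'.Mem Q P R := by
  obtain ⟨p, q, d, r, e⟩ := t
  have h4 : (3 : ZMod 4) = -1 := rfl
  simp only [orders, List.mem_cons, List.not_mem_nil, or_false] at hs
  simp only [orders, List.mem_cons, List.not_mem_nil, or_false, exists_eq_or_imp, exists_eq_left]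
  rcases hs with rfl | rfl | rfl | rfl | rfl | rfl <;> obtain ⟨h1, h2, h3, h5, h6⟩ := h <;>
    push_cast [h4] at h5 h6 <;>
    simp only [Mem, Nat.cast_add, Nat.cast_mul, Nat.cast_ofNat, h4, h1, h2, h3, h5, h6]
  · exact Or.inr (Or.inr (Or.inl ⟨trivial, trivial, trivial, by ring, by ring⟩))
  · exact Or.inr (Or.inr (Or.inr (Or.inr (Or.inl ⟨trivial, trivial, trivial, by ring, by ring⟩))))
  · exact Or.inl ⟨trivial, trivial, trivial, by ring, by ring⟩
  · exact Or.inr (Or.inr (Or.inr (Or.inr (Or.inr ⟨trivial, trivial, trivial, by ring, by ring⟩))))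
  · exact Or.inr (Or.inl ⟨trivial, trivial, trivial, by ring, by ring⟩)
  · exact Or.inr (Or.inr (Or.inr (Or.inl ⟨trivial, trivial, trivial, by ring, by ring⟩)))

theorem Mem.swap_right {n : ℕ} {P Q R : Fin n × ZMod 4} {s t : BaseBlock} (hs : s ∈ t.orders)
    (h : s.Mem P Q R) : ∃ s' ∈ t.orders, s'.Mem P R Q := by
  obtain ⟨p, q, d, r, e⟩ := t
  simp only [orders, List.mem_cons, List.not_mem_nil, or_false] at hs
  simp only [orders, List.mem_cons, List.not_mem_nil, or_false, exists_eq_or_imp, exists_eq_left]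
  rcases hs with rfl | rfl | rfl | rfl | rfl | rfl <;> obtain ⟨h1, h2, h3, h5, h6⟩ := h
  · exact Or.inr (Or.inl ⟨h1, h3, h2, h6, h5⟩)
  · exact Or.inl ⟨h1, h3, h2, h6, h5⟩
  · exact Or.inr (Or.inr (Or.inr (Or.inl ⟨h1, h3, h2, h6, h5⟩)))
  · exact Or.inr (Or.inr (Or.inl ⟨h1, h3, h2, h6, h5⟩))
  · exact Or.inr (Or.inr (Or.inr (Or.inr (Or.inr ⟨h1, h3, h2, h6, h5⟩))))
  · exact Or.inr (Or.inr (Or.inr (Or.inr (Or.inl ⟨h1, h3, h2, h6, h5⟩))))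

end BaseBlock

/-- Starting from the set of bits of `m`, the entries of `l` are new, pairwise distinct bits
that extend it to the set of bits of `t`. -/
def fillsBits (t : ℕ) : List ℕ → ℕ → Bool
  | [], m => m == t
  | k :: l, m => !m.testBit k && fillsBits t l (m ||| 1 <<< k)

theorem testBit_or_one_shiftLeft (m k i : ℕ) :
    (m ||| 1 <<< k).testBit i = true ↔ m.testBit i = true ∨ i = k := by
  rw [Nat.testBit_or, Bool.or_eq_true, Nat.one_shiftLeft, Nat.testBit_two_pow, decide_eq_true_iff,
    eq_comm (a := k)]

theorem nodup_of_fillsBits {t m : ℕ} {l : List ℕ} (h : fillsBits t l m = true) :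
    (∀ k ∈ l, m.testBit k = false) ∧ l.Nodup ∧
      ∀ k, t.testBit k = true ↔ m.testBit k = true ∨ k ∈ l := by
  induction l generalizing m with
  | nil => simp_all [fillsBits]
  | cons k l ih =>
    simp only [fillsBits, Bool.and_eq_true, Bool.not_eq_true'] at h
    obtain ⟨h1, h2, h3⟩ := ih h.2
    simp only [← Bool.not_eq_true, testBit_or_one_shiftLeft, not_or] at h1 h3
    refine ⟨?_, List.nodup_cons.2 ⟨fun hk => (h1 k hk).2 rfl, h2⟩, fun i => ?_⟩
    · rintro i hi
      rcases List.mem_cons.1 hi with rfl | hi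
      · exact h.1
      · simpa using (h1 i hi).1
    · rw [h3, List.mem_cons, or_assoc]

/-- The number whose bits are the entries of `l`. -/
def bitsOf (l : List ℕ) : ℕ := l.foldr (fun k m => m ||| 1 <<< k) 0

theorem testBit_bitsOf (l : List ℕ) (i : ℕ) : (bitsOf l).testBit i = true ↔ i ∈ l := by
  induction l with
  | nil => simp [bitsOf]
  | cons k l ih =>
    rw [List.mem_cons, or_comm, ← ih]
    exact testBit_or_one_shiftLeft _ _ _

/-- The sides of the cyclic lift of the graph `adj` on `n` points, encoded by numbers. -/
def liftKeys (n : ℕ) (adj : ℕ → ℕ → Bool) : List ℕ :=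
  (List.range n).flatMap fun a => ((List.range n).filter (adj a)).flatMap fun b =>
    (List.range 4).map fun g => (a * n + b) * 4 + g

/-- The translates of the base blocks in `L` decompose the lift of the graph `adj`. -/
def decomposes (n : ℕ) (adj : ℕ → ℕ → Bool) (L : List BaseBlock) : Bool :=
  L.all (BaseBlock.inRange n) &&
    fillsBits (bitsOf (liftKeys n adj)) ((L.flatMap BaseBlock.orders).map (BaseBlock.key n)) 0

theorem mul_add_injective {n a b a' b' g g' : ℕ} (hb : b < n) (hb' : b' < n) (hg : g < 4)
    (hg' : g' < 4) (h : (a * n + b) * 4 + g = (a' * n + b') * 4 + g') :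
    a = a' ∧ b = b' ∧ g = g' := by
  have h1 : a * n + b = a' * n + b' := by omega
  have h2 : b = b' := by
    have := congrArg (· % n) h1
    simpa [Nat.mod_eq_of_lt hb, Nat.mod_eq_of_lt hb'] using this
  refine ⟨?_, h2, by omega⟩
  subst h2
  exact Nat.eq_of_mul_eq_mul_right (by omega : 0 < n) (Nat.add_right_cancel h1)

theorem natCast_eq_of_mod_eq {a b : ℕ} (h : a % 4 = b % 4) : (a : ZMod 4) = b :=
  (ZMod.natCast_eq_natCast_iff a b 4).2 h

theorem mem_liftKeys {n a b g : ℕ} {adj : ℕ → ℕ → Bool} (ha : a < n) (hb : b < n) (hg : g < 4) :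
    (a * n + b) * 4 + g ∈ liftKeys n adj ↔ adj a b = true := by
  simp only [liftKeys, List.mem_flatMap, List.mem_range, List.mem_filter, List.mem_map]
  constructor
  · rintro ⟨a', -, b', ⟨hb', hab⟩, g', hg', h⟩
    obtain ⟨rfl, rfl, -⟩ := mul_add_injective hb' hb hg' hg h
    exact hab
  · intro hab
    exact ⟨a, ha, b, ⟨hb, hab⟩, g, hg, rfl⟩

theorem hasCyclicLift_of_decomposes {n : ℕ} {adj : ℕ → ℕ → Bool} {L : List BaseBlock}
    (h : decomposes n adj L = true) :
    HasCyclicLift (fun a b : Fin n => adj a b = true) := by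
  rw [decomposes, Bool.and_eq_true, List.all_eq_true] at h
  obtain ⟨hr, hf⟩ := h
  obtain ⟨-, hnd, hcov⟩ := nodup_of_fillsBits hf
  simp only [testBit_bitsOf, Nat.zero_testBit, Bool.false_eq_true, false_or] at hcov
  have hinj := List.inj_on_of_nodup_map hnd
  refine ⟨fun P Q R => ∃ t ∈ L, ∃ s ∈ t.orders, s.Mem P Q R, ⟨?_, ?_, ?_, ?_, ?_⟩, ?_⟩
  · rintro P Q R ⟨t, ht, s, hs, h⟩
    exact ⟨t, ht, h.swap hs⟩
  · rintro P Q R ⟨t, ht, s, hs, h⟩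
    obtain ⟨s', hs', h'⟩ := h.swap hs
    exact ⟨t, ht, h'.swap_right hs'⟩
  · rintro P Q R ⟨t, ht, ⟨p, q, d, r, e⟩, hs, h1, h2, -⟩
    have := (hcov ((p * n + q) * 4 + d % 4)).2
      (List.mem_map.2 ⟨_, List.mem_flatMap.2 ⟨t, ht, hs⟩, rfl⟩)
    rw [← h1, ← h2] at this
    exact (mem_liftKeys P.1.2 Q.1.2 (Nat.mod_lt _ (by norm_num))).1 this
  · rintro ⟨a, x⟩ ⟨b, y⟩ hab
    obtain ⟨s, hs, hk⟩ := List.mem_map.1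
      ((hcov ((a * n + b) * 4 + (y - x).val)).1 ((mem_liftKeys a.2 b.2 (ZMod.val_lt _)).2 hab))
    obtain ⟨t, ht, hst⟩ := List.mem_flatMap.1 hs
    obtain ⟨p, q, d, r, e⟩ := s
    have hlt : q < n ∧ r < n := by
      have := hr t ht
      obtain ⟨p', q', d', r', e'⟩ := t
      simp only [BaseBlock.inRange, Bool.and_eq_true, decide_eq_true_iff] at this
      simp only [BaseBlock.orders, List.mem_cons, List.not_mem_nil, or_false, Prod.mk.injEq] at hst
      omega
    obtain ⟨rfl, rfl, hd⟩ :=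
      mul_add_injective hlt.1 b.2 (Nat.mod_lt _ (by norm_num)) (ZMod.val_lt _) hk
    refine ⟨(⟨r, hlt.2⟩, x + e), t, ht, _, hst, rfl, rfl, rfl, ?_, rfl⟩
    have : (d : ZMod 4) = ((y - x).val : ℕ) :=
      natCast_eq_of_mod_eq (by rw [hd, Nat.mod_eq_of_lt (ZMod.val_lt _)])
    simp [this]
  · rintro P Q ⟨c, z⟩ ⟨c', z'⟩ ⟨t, ht, ⟨p, q, d, r, e⟩, hs, h1, h2, h3, h4, h5⟩
      ⟨t', ht', ⟨p', q', d', r', e'⟩, hs', h1', h2', h3', h4', h5'⟩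
    have hd : d % 4 = d' % 4 :=
      (ZMod.natCast_eq_natCast_iff d d' 4).1 (add_left_cancel (h4.symm.trans h4'))
    have := hinj (List.mem_flatMap.2 ⟨t, ht, hs⟩) (List.mem_flatMap.2 ⟨t', ht', hs'⟩)
      (by simp only [BaseBlock.key, ← h1, ← h2, ← h1', ← h2', hd])
    simp only [Prod.mk.injEq] at this
    obtain ⟨-, -, -, rfl, rfl⟩ := this
    exact Prod.ext (Fin.ext (h3.trans h3'.symm)) (h5.trans h5'.symm)
  · rintro P Q R ⟨t, ht, ⟨p, q, d, r, e⟩, hs, h1, h2, h3, h4, h5⟩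
    refine ⟨t, ht, _, hs, h1, h2, h3, ?_, ?_⟩
    · rw [h4]
      ring
    · rw [h5]
      ring

theorem hasCyclicLift_prod_of_decomposes {m n : ℕ} {γ δ : ℕ → ℕ → Bool}
    {E : Fin n → Fin n → Prop} {F : Fin m → Fin m → Prop} {L : List BaseBlock}
    (hE : ∀ a b, E a b ↔ γ a b = true) (hF : ∀ a b, F a b ↔ δ a b = true)
    (h : decomposes (n * m) (fun a b => γ (a / m) (b / m) && δ (a % m) (b % m)) L = true) :
    HasCyclicLift (prodRel E F) := by
  refine (hasCyclicLift_of_decomposes h).of_equiv finProdFinEquiv fun a b => ?_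
  have div_eq (c : Fin n × Fin m) : (c.2 + m * c.1 : ℕ) / m = c.1 := by
    rw [Nat.add_mul_div_left _ _ (by have := c.2.2; omega), Nat.div_eq_of_lt c.2.2, zero_add]
  have mod_eq (c : Fin n × Fin m) : (c.2 + m * c.1 : ℕ) % m = c.2 := by
    rw [Nat.add_mul_mod_self_left, Nat.mod_eq_of_lt c.2.2]
  simp [prodRel, div_eq, mod_eq, hE, hF]

/-- The complete graph without the edge between its first two vertices. -/
def punctured (n : ℕ) (a b : Fin n) : Prop := a ≠ b ∧ ¬((a : ℕ) < 2 ∧ (b : ℕ) < 2)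

theorem ne_iff_bne {n : ℕ} (a b : Fin n) : a ≠ b ↔ bne (a : ℕ) b = true := by
  simp [Fin.ext_iff]

/-- The graph `punctured` on natural numbers. -/
def puncturedCode (a b : ℕ) : Bool := a != b && !(a < 2 && b < 2)

/-- The graph `offHole` on natural numbers, with hole at `0`. -/
def offHoleCode (a b : ℕ) : Bool := !(a == 0 && b == 0)

theorem punctured_iff {n : ℕ} (a b : Fin n) :
    punctured n a b ↔ puncturedCode a b = true := by
  simp only [punctured, puncturedCode, Fin.ext_iff, ne_eq, Bool.and_eq_true, bne_iff_ne,
    Bool.not_eq_true', ← Bool.not_eq_true, decide_eq_true_iff]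

theorem offHole_iff (a b : Fin 2) :
    offHole 0 a b ↔ offHoleCode a b = true := by
  simp only [offHole, offHoleCode, Fin.ext_iff, Fin.val_zero, Bool.and_eq_true, beq_iff_eq,
    Bool.not_eq_true', ← Bool.not_eq_true]

/-- The permutation shifting the interval `[lo, lo + len)` cyclically. -/
def rotate (lo len x : ℕ) : ℕ :=
  if lo ≤ x ∧ x < lo + len then lo + (x - lo + 1) % len else x

/-- The action on the first coordinate of the code `a * m + b` of the pair `(a, b)`. -/
def onLeft (m : ℕ) (f : ℕ → ℕ) (x : ℕ) : ℕ := f (x / m) * m + x % m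

/-- The action on the second coordinate of the code `a * m + b` of the pair `(a, b)`. -/
def onRight (m : ℕ) (f : ℕ → ℕ) (x : ℕ) : ℕ := x / m * m + f (x % m)

/-- The images of the base blocks in `L` under the first `k` iterates of `f`. -/
def orbit (f : ℕ → ℕ) (k : ℕ) (L : List BaseBlock) : List BaseBlock :=
  (List.range k).flatMap fun i => L.map (BaseBlock.map f^[i])

/-- Orbit representatives for the product of `K₃` and an edge with two loops. -/
def blocksK3T : List BaseBlock :=
  [(0, 2, 0, 4, 0), (0, 2, 1, 4, 2), (0, 2, 2, 4, 1), (0, 2, 3, 5, 0), (0, 3, 0, 4, 3),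
   (0, 3, 1, 5, 1), (0, 3, 2, 5, 3), (0, 3, 3, 5, 2), (1, 2, 0, 4, 2), (1, 2, 1, 5, 0),
   (1, 2, 2, 5, 2), (1, 2, 3, 5, 1), (1, 3, 0, 4, 0), (1, 3, 2, 4, 3), (1, 3, 3, 4, 1),
   (1, 3, 1, 5, 3)]

/-- Orbit representatives for the product of `K₆` and an edge with one loop. -/
def blocksK6S : List BaseBlock :=
  [(0, 3, 0, 5, 1), (0, 3, 2, 7, 3), (1, 2, 2, 5, 1), (1, 2, 3, 7, 3), (1, 2, 0, 11, 2),
   (1, 2, 1, 11, 0), (2, 5, 1, 7, 1), (2, 5, 0, 9, 0), (2, 5, 2, 9, 1), (2, 7, 3, 9, 2),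
   (2, 7, 2, 11, 0), (2, 9, 3, 11, 1)]

/-- Orbit representatives for the product of `K₆` and `K₃`. -/
def blocksK6K3 : List BaseBlock :=
  [(0, 4, 3, 8, 1), (0, 4, 0, 14, 2), (0, 4, 1, 14, 0), (0, 4, 2, 14, 3), (3, 7, 1, 11, 0),
   (3, 7, 0, 14, 3), (3, 8, 0, 10, 2), (3, 8, 1, 10, 0)]

/-- Orbit representatives for the product of `K₆` and `K₄`. -/
def blocksK6K4 : List BaseBlock :=
  [(0, 5, 3, 11, 1), (0, 5, 0, 14, 2), (1, 4, 0, 10, 2), (1, 4, 1, 15, 3), (1, 4, 2, 22, 3),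
   (1, 4, 3, 23, 2), (1, 6, 0, 15, 0), (1, 6, 1, 19, 1), (4, 9, 1, 15, 1), (4, 9, 0, 18, 3),
   (4, 9, 3, 23, 2), (4, 13, 0, 18, 0), (4, 13, 3, 18, 2), (4, 17, 1, 23, 0), (5, 10, 1, 15, 3),
   (5, 11, 1, 18, 3)]

/-- Orbit representatives for the product of `K₆` and `K₆`. -/
def blocksK6K6 : List BaseBlock :=
  [(0, 7, 3, 17, 1), (0, 7, 2, 20, 0), (1, 6, 3, 14, 2), (1, 6, 0, 16, 2), (1, 6, 2, 26, 1),
   (1, 6, 1, 33, 1), (1, 8, 0, 27, 2), (1, 8, 3, 29, 3), (1, 9, 0, 17, 2), (1, 9, 3, 22, 0),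
   (1, 10, 3, 29, 0), (1, 10, 1, 35, 1), (6, 13, 1, 21, 1), (6, 13, 0, 22, 0), (6, 19, 2, 28, 1),
   (6, 19, 3, 34, 2), (6, 25, 0, 34, 1), (6, 25, 2, 35, 3), (7, 14, 2, 21, 2), (7, 14, 3, 29, 1),
   (7, 14, 1, 34, 1), (7, 15, 1, 29, 0), (7, 16, 2, 27, 3), (7, 17, 3, 28, 3)]

/-- Orbit representatives for the product of `K₆` minus an edge and an edge with one loop. -/
def blocksK6ES : List BaseBlock :=
  [(0, 5, 3, 7, 3), (0, 5, 2, 9, 0), (0, 5, 0, 11, 3), (0, 5, 1, 11, 1), (0, 7, 0, 9, 2),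
   (0, 7, 2, 9, 3), (0, 7, 1, 11, 0), (0, 9, 1, 11, 2), (1, 4, 0, 7, 0), (1, 4, 1, 9, 0),
   (1, 4, 2, 11, 2), (1, 4, 3, 11, 1), (1, 5, 2, 6, 1), (1, 5, 3, 6, 0), (1, 5, 0, 8, 2),
   (1, 5, 1, 8, 1), (1, 6, 3, 9, 3), (1, 6, 2, 11, 3), (1, 7, 1, 8, 3), (1, 7, 2, 10, 3),
   (1, 7, 3, 10, 2), (1, 8, 0, 11, 0), (1, 9, 1, 10, 1), (1, 9, 2, 10, 0), (2, 5, 1, 7, 2),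
   (2, 5, 0, 9, 0), (2, 5, 2, 9, 3), (2, 5, 3, 11, 0), (2, 7, 1, 9, 1), (2, 7, 0, 11, 1),
   (2, 7, 3, 11, 3), (2, 9, 2, 11, 2), (3, 4, 3, 7, 0), (3, 4, 1, 9, 1), (3, 4, 2, 9, 0),
   (3, 4, 0, 11, 3), (3, 5, 0, 6, 0), (3, 5, 1, 6, 3), (3, 5, 2, 10, 2), (3, 5, 3, 10, 0),
   (3, 6, 1, 9, 3), (3, 6, 2, 11, 2), (3, 7, 1, 8, 1), (3, 7, 2, 8, 3), (3, 7, 3, 10, 1),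
   (3, 8, 0, 11, 1), (3, 8, 2, 11, 0), (3, 9, 2, 10, 3), (4, 7, 2, 9, 1), (4, 7, 3, 11, 1),
   (5, 7, 2, 8, 1), (5, 7, 3, 10, 3), (5, 8, 3, 11, 2), (5, 9, 3, 10, 2), (6, 9, 1, 11, 3),
   (6, 9, 3, 11, 2)]

/-- Orbit representatives for the product of `K₆` minus an edge and `K₃`. -/
def blocksK6EK3 : List BaseBlock :=
  [(0, 7, 0, 11, 0), (0, 7, 2, 14, 2), (0, 7, 3, 14, 1), (0, 7, 1, 17, 2), (0, 8, 3, 10, 1),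
   (0, 8, 0, 13, 1), (0, 8, 2, 13, 2), (0, 8, 1, 16, 1), (0, 10, 2, 14, 0), (0, 10, 0, 17, 3),
   (0, 10, 3, 17, 0), (0, 11, 1, 13, 3), (0, 11, 2, 16, 0), (0, 11, 3, 16, 2), (0, 13, 0, 17, 1),
   (0, 14, 3, 16, 3), (1, 6, 0, 11, 2), (1, 6, 1, 11, 0), (1, 6, 3, 14, 1), (1, 6, 2, 17, 3),
   (1, 8, 3, 9, 2), (1, 8, 2, 12, 3), (1, 8, 0, 15, 2), (1, 8, 1, 15, 0), (1, 9, 0, 14, 2),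
   (1, 9, 3, 14, 3), (1, 9, 1, 17, 1), (1, 11, 1, 12, 2), (1, 11, 3, 15, 1), (1, 12, 0, 17, 2),
   (1, 12, 1, 17, 0), (1, 14, 0, 15, 3), (2, 6, 2, 10, 0), (2, 6, 3, 13, 1), (2, 6, 0, 16, 0),
   (2, 6, 1, 16, 2), (2, 7, 0, 9, 3), (2, 7, 1, 9, 2), (2, 7, 2, 12, 1), (2, 7, 3, 15, 0),
   (2, 9, 1, 13, 3), (2, 9, 0, 16, 3), (2, 10, 2, 12, 0), (2, 10, 3, 12, 3), (2, 10, 1, 15, 3),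
   (2, 12, 2, 16, 1), (2, 13, 0, 15, 2), (2, 13, 2, 15, 1), (6, 10, 0, 14, 3), (6, 11, 0, 13, 1),
   (6, 13, 0, 17, 3), (6, 14, 1, 16, 3), (7, 11, 1, 12, 1), (7, 11, 3, 15, 3), (7, 12, 0, 17, 0),
   (8, 12, 3, 16, 3)]

/-- Orbit representatives for the product of `K₆` minus an edge and `K₄`. -/
def blocksK6EK4 : List BaseBlock :=
  [(0, 9, 0, 14, 0), (0, 9, 1, 14, 2), (0, 9, 3, 19, 0), (0, 9, 2, 23, 3), (0, 10, 3, 15, 1),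
   (0, 10, 1, 23, 2), (1, 8, 0, 14, 0), (1, 8, 1, 14, 2), (1, 8, 3, 15, 0), (1, 8, 2, 19, 3),
   (1, 10, 1, 15, 2), (1, 10, 3, 23, 1), (2, 8, 0, 13, 1), (2, 8, 1, 13, 3), (2, 8, 2, 15, 1),
   (2, 8, 3, 15, 3), (2, 9, 2, 19, 0), (2, 9, 0, 23, 2), (3, 8, 0, 13, 3), (3, 8, 1, 14, 3),
   (3, 8, 2, 17, 0), (3, 8, 3, 18, 2), (3, 9, 2, 14, 1), (3, 9, 1, 18, 0), (4, 9, 0, 14, 2),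
   (4, 9, 1, 15, 0), (4, 9, 2, 15, 2), (4, 9, 3, 18, 0), (4, 10, 1, 19, 1), (4, 10, 3, 23, 3),
   (5, 8, 0, 18, 0), (5, 8, 1, 18, 2), (5, 8, 3, 19, 2), (5, 8, 2, 23, 3), (5, 10, 3, 19, 1),
   (5, 10, 1, 23, 0), (6, 8, 0, 17, 0), (6, 8, 2, 21, 2), (6, 8, 1, 23, 1), (6, 8, 3, 23, 2),
   (6, 9, 1, 19, 0), (6, 9, 3, 19, 3), (7, 8, 0, 17, 3), (7, 8, 2, 21, 0), (7, 8, 1, 22, 1),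
   (7, 8, 3, 22, 0), (7, 9, 1, 22, 3), (7, 9, 2, 22, 2), (8, 13, 0, 22, 2), (8, 14, 3, 19, 2),
   (8, 15, 2, 22, 3), (8, 17, 1, 23, 2), (8, 18, 2, 21, 3), (8, 19, 0, 21, 1), (9, 15, 2, 22, 1),
   (9, 18, 0, 23, 0)]

/-- Orbit representatives for the product of `K₆` minus an edge and `K₆`. -/
def blocksK6EK6 : List BaseBlock :=
  [(0, 13, 0, 20, 3), (0, 13, 1, 22, 2), (1, 12, 3, 21, 1), (1, 12, 1, 22, 1), (1, 12, 2, 26, 1),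
   (1, 12, 0, 27, 2), (1, 14, 0, 22, 0), (1, 14, 2, 23, 0), (1, 14, 3, 27, 0), (1, 15, 3, 29, 2),
   (1, 16, 3, 23, 3), (1, 16, 2, 35, 1), (6, 13, 1, 20, 3), (6, 13, 2, 23, 0), (7, 12, 2, 23, 3),
   (7, 12, 3, 29, 0), (7, 12, 1, 33, 1), (7, 12, 0, 34, 1), (7, 14, 1, 21, 2), (7, 14, 3, 23, 2),
   (7, 14, 0, 28, 0), (7, 14, 2, 34, 2), (7, 15, 0, 28, 3), (7, 15, 3, 29, 1), (12, 19, 3, 34, 2),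
   (12, 25, 0, 33, 3), (13, 21, 1, 26, 0), (13, 21, 2, 32, 0)]

/-- Orbit representatives for the product of `K₈` and an edge with one loop. -/
def blocksK8S : List BaseBlock :=
  [(0, 3, 0, 7, 3), (0, 3, 1, 7, 2), (1, 2, 2, 11, 3), (1, 2, 0, 15, 2), (1, 2, 1, 15, 1),
   (1, 2, 3, 15, 0), (2, 5, 3, 7, 2), (2, 5, 2, 9, 2), (2, 5, 0, 11, 0), (2, 5, 1, 13, 2),
   (2, 7, 3, 9, 3), (2, 7, 0, 13, 1), (2, 7, 1, 15, 3), (2, 9, 0, 11, 2), (2, 9, 1, 13, 3),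
   (2, 11, 3, 13, 0)]

/-- Orbit representatives for the product of `K₈` and `K₃`. -/
def blocksK8K3 : List BaseBlock :=
  [(0, 4, 3, 8, 3), (0, 4, 1, 11, 2), (0, 4, 2, 11, 1), (0, 4, 0, 14, 0), (1, 3, 3, 17, 0),
   (1, 3, 0, 20, 2), (1, 3, 2, 20, 1), (1, 3, 1, 23, 3), (2, 3, 0, 7, 1), (2, 3, 1, 7, 3),
   (2, 3, 3, 7, 2), (2, 3, 2, 10, 0), (3, 7, 0, 11, 2), (3, 8, 0, 10, 1), (3, 8, 1, 13, 0),
   (3, 8, 2, 13, 2), (3, 8, 3, 22, 3), (3, 10, 0, 14, 3), (3, 10, 3, 20, 0), (3, 11, 1, 16, 2),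
   (3, 11, 0, 19, 3), (3, 11, 3, 19, 1), (3, 13, 1, 23, 0), (3, 13, 3, 23, 1), (3, 14, 1, 16, 3),
   (3, 14, 0, 22, 1), (3, 14, 2, 22, 2), (3, 16, 0, 20, 1), (3, 16, 1, 23, 3), (3, 17, 0, 19, 0),
   (3, 17, 3, 19, 2), (3, 17, 2, 22, 0)]

/-- Orbit representatives for the product of `K₈` and `K₄`. -/
def blocksK8K4 : List BaseBlock :=
  [(0, 5, 0, 10, 1), (0, 5, 3, 11, 0), (0, 5, 1, 18, 0), (0, 5, 2, 31, 2), (0, 6, 2, 11, 1),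
   (0, 6, 3, 11, 3), (4, 9, 2, 19, 2), (4, 9, 1, 22, 1), (4, 10, 3, 13, 3), (4, 10, 2, 17, 3),
   (4, 11, 3, 18, 1), (4, 11, 2, 21, 0), (4, 13, 1, 22, 0), (4, 13, 0, 23, 3), (4, 14, 1, 21, 3),
   (4, 14, 2, 21, 2)]

/-- Orbit representatives for the product of `K₈` and `K₆`. -/
def blocksK8K6 : List BaseBlock :=
  [(0, 7, 0, 21, 3), (0, 7, 2, 22, 1), (1, 6, 3, 21, 3), (1, 6, 0, 26, 0), (1, 6, 2, 34, 0),
   (1, 6, 1, 40, 3), (1, 8, 2, 29, 0), (1, 8, 3, 29, 2), (1, 8, 1, 33, 0), (1, 9, 1, 28, 1),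
   (1, 9, 2, 29, 1), (1, 10, 2, 29, 3), (6, 13, 1, 29, 1), (6, 13, 2, 33, 0), (6, 13, 0, 35, 3),
   (6, 13, 3, 39, 3), (6, 19, 2, 26, 2), (6, 19, 1, 32, 1), (6, 19, 3, 44, 3), (6, 25, 3, 45, 0),
   (6, 37, 1, 44, 2), (6, 37, 0, 46, 1), (7, 14, 3, 28, 1), (7, 14, 2, 46, 0), (7, 15, 1, 26, 3),
   (7, 15, 2, 29, 2), (7, 15, 3, 44, 2), (7, 16, 3, 20, 3), (7, 16, 2, 21, 1), (7, 17, 0, 22, 1),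
   (7, 20, 2, 39, 0), (7, 23, 3, 34, 0)]

/-- Orbit representatives for the product of `K₈` minus an edge and an edge with one loop. -/
def blocksK8ES : List BaseBlock :=
  [(0, 5, 0, 9, 1), (0, 5, 3, 9, 2), (0, 7, 0, 11, 1), (0, 7, 3, 11, 2), (1, 4, 0, 9, 2),
   (1, 4, 1, 7, 2), (1, 4, 2, 7, 1), (1, 4, 3, 7, 3), (1, 5, 3, 6, 3), (1, 5, 0, 10, 1),
   (1, 5, 1, 10, 0), (1, 6, 2, 15, 0), (2, 5, 0, 9, 2), (2, 5, 1, 7, 3), (2, 5, 3, 11, 1),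
   (2, 7, 0, 11, 2), (3, 4, 0, 9, 1), (3, 4, 3, 7, 1), (3, 4, 1, 11, 2), (3, 4, 2, 15, 0),
   (3, 5, 0, 6, 1), (3, 5, 2, 14, 3), (3, 5, 3, 14, 2), (3, 6, 0, 11, 3), (4, 9, 0, 13, 0),
   (4, 9, 3, 15, 0), (4, 13, 2, 11, 2), (4, 13, 3, 11, 0), (4, 13, 1, 15, 1), (4, 11, 3, 15, 3),
   (5, 6, 2, 11, 0), (5, 6, 3, 15, 3), (5, 7, 1, 10, 0), (5, 7, 3, 14, 2), (5, 10, 2, 15, 2),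
   (5, 11, 3, 14, 0)]

/-- Orbit representatives for the product of `K₈` minus an edge and `K₃`. -/
def blocksK8EK3 : List BaseBlock :=
  [(0, 7, 0, 14, 2), (0, 7, 1, 20, 3), (0, 7, 2, 20, 1), (0, 7, 3, 17, 2), (0, 8, 0, 10, 3),
   (0, 10, 0, 23, 3), (0, 10, 1, 23, 1), (0, 10, 2, 23, 0), (3, 7, 1, 20, 2), (3, 7, 0, 23, 2),
   (3, 7, 2, 23, 1), (3, 7, 3, 23, 0), (3, 8, 1, 10, 3), (3, 8, 0, 16, 2), (3, 8, 3, 22, 0),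
   (3, 10, 1, 17, 3), (6, 13, 0, 11, 0), (6, 13, 1, 17, 0), (6, 13, 3, 23, 0), (6, 14, 0, 10, 2),
   (6, 10, 0, 17, 3), (6, 10, 1, 17, 1), (6, 11, 1, 16, 0), (6, 16, 2, 23, 3)]

/-- Orbit representatives for the product of `K₈` minus an edge and `K₄`. -/
def blocksK8EK4 : List BaseBlock :=
  [(0, 9, 2, 15, 3), (0, 9, 0, 22, 1), (1, 8, 1, 18, 2), (1, 8, 2, 23, 3), (1, 8, 3, 23, 1),
   (1, 8, 0, 30, 3), (1, 10, 1, 23, 0), (1, 10, 0, 31, 2), (4, 9, 0, 15, 3), (4, 9, 1, 18, 2),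
   (5, 8, 3, 15, 1), (5, 8, 2, 22, 1), (5, 8, 0, 26, 3), (5, 8, 1, 31, 3), (5, 10, 0, 19, 2),
   (5, 10, 2, 23, 0), (8, 13, 1, 18, 0), (8, 13, 0, 22, 0), (8, 13, 3, 30, 0), (8, 17, 2, 27, 2),
   (8, 17, 3, 27, 0), (8, 25, 1, 31, 1), (9, 14, 0, 19, 2), (9, 14, 1, 23, 0)]

/-- Orbit representatives for the product of `K₈` minus an edge and `K₆`. -/
def blocksK8EK6 : List BaseBlock :=
  [(0, 13, 2, 29, 0), (0, 13, 1, 33, 3), (1, 12, 3, 21, 3), (1, 12, 0, 33, 1), (1, 12, 1, 41, 1),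
   (1, 12, 2, 47, 2), (1, 14, 1, 22, 1), (1, 14, 3, 23, 3), (1, 14, 0, 28, 0), (1, 14, 2, 40, 2),
   (1, 15, 0, 35, 0), (1, 15, 2, 40, 3), (6, 13, 1, 26, 2), (6, 13, 0, 32, 3), (7, 12, 1, 20, 2),
   (7, 12, 3, 27, 2), (7, 12, 0, 32, 3), (7, 12, 2, 41, 0), (7, 14, 1, 22, 2), (7, 14, 0, 29, 1),
   (7, 15, 3, 22, 3), (7, 15, 0, 41, 2), (7, 15, 1, 46, 0), (7, 16, 1, 47, 3), (12, 19, 3, 28, 2),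
   (12, 19, 2, 44, 2), (12, 25, 0, 34, 2), (12, 25, 1, 47, 3), (12, 31, 0, 41, 3),
   (12, 37, 1, 47, 1), (13, 20, 3, 33, 3), (13, 20, 2, 34, 3), (13, 20, 1, 35, 0),
   (13, 21, 3, 29, 1), (13, 22, 1, 41, 2), (13, 26, 3, 40, 2)]

theorem hasCyclicLift_three_top :
    HasCyclicLift (prodRel (fun a b : Fin 3 => a ≠ b) (fun _ _ : Fin 2 => True)) :=
  hasCyclicLift_prod_of_decomposes (δ := fun _ _ => true) ne_iff_bne (by simp)
    (L := blocksK3T)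
    (by decide +kernel)

theorem hasCyclicLift_six_edgeLoop :
    HasCyclicLift (prodRel (fun a b : Fin 6 => a ≠ b) (offHole (0 : Fin 2))) :=
  hasCyclicLift_prod_of_decomposes ne_iff_bne offHole_iff
    (L := orbit (onLeft 2 (rotate 1 5)) 5 <|
      blocksK6S)
    (by decide +kernel)

theorem hasCyclicLift_six_three :
    HasCyclicLift (prodRel (fun a b : Fin 6 => a ≠ b) (fun a b : Fin 3 => a ≠ b)) :=
  hasCyclicLift_prod_of_decomposes ne_iff_bne ne_iff_bne
    (L := orbit (onRight 3 (rotate 0 3)) 3 <|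
      orbit (onLeft 3 (rotate 1 5)) 5 <|
      blocksK6K3)
    (by decide +kernel)

theorem hasCyclicLift_six_four :
    HasCyclicLift (prodRel (fun a b : Fin 6 => a ≠ b) (fun a b : Fin 4 => a ≠ b)) :=
  hasCyclicLift_prod_of_decomposes ne_iff_bne ne_iff_bne
    (L := orbit (onRight 4 (rotate 1 3)) 3 <|
      orbit (onLeft 4 (rotate 1 5)) 5 <|
      blocksK6K4)
    (by decide +kernel)

theorem hasCyclicLift_six_six :
    HasCyclicLift (prodRel (fun a b : Fin 6 => a ≠ b) (fun a b : Fin 6 => a ≠ b)) :=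
  hasCyclicLift_prod_of_decomposes ne_iff_bne ne_iff_bne
    (L := orbit (onRight 6 (rotate 1 5)) 5 <|
      orbit (onLeft 6 (rotate 1 5)) 5 <|
      blocksK6K6)
    (by decide +kernel)

theorem hasCyclicLift_puncturedSix_edgeLoop :
    HasCyclicLift (prodRel (punctured 6) (offHole (0 : Fin 2))) :=
  hasCyclicLift_prod_of_decomposes punctured_iff offHole_iff
    (L := blocksK6ES)
    (by decide +kernel)

theorem hasCyclicLift_puncturedSix_three :
    HasCyclicLift (prodRel (punctured 6) (fun a b : Fin 3 => a ≠ b)) :=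
  hasCyclicLift_prod_of_decomposes punctured_iff ne_iff_bne
    (L := orbit (onLeft 3 (· ^^^ 1)) 2 <|
      blocksK6EK3)
    (by decide +kernel)

theorem hasCyclicLift_puncturedSix_four :
    HasCyclicLift (prodRel (punctured 6) (fun a b : Fin 4 => a ≠ b)) :=
  hasCyclicLift_prod_of_decomposes punctured_iff ne_iff_bne
    (L := orbit (onLeft 4 (rotate 2 4)) 4 <|
      blocksK6EK4)
    (by decide +kernel)

theorem hasCyclicLift_puncturedSix_six :
    HasCyclicLift (prodRel (punctured 6) (fun a b : Fin 6 => a ≠ b)) :=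
  hasCyclicLift_prod_of_decomposes punctured_iff ne_iff_bne
    (L := orbit (onRight 6 (rotate 1 5)) 5 <|
      orbit (onLeft 6 (rotate 2 4)) 4 <|
      blocksK6EK6)
    (by decide +kernel)

theorem hasCyclicLift_eight_edgeLoop :
    HasCyclicLift (prodRel (fun a b : Fin 8 => a ≠ b) (offHole (0 : Fin 2))) :=
  hasCyclicLift_prod_of_decomposes ne_iff_bne offHole_iff
    (L := orbit (onLeft 2 (rotate 1 7)) 7 <|
      blocksK8S)
    (by decide +kernel)

theorem hasCyclicLift_eight_three :
    HasCyclicLift (prodRel (fun a b : Fin 8 => a ≠ b) (fun a b : Fin 3 => a ≠ b)) :=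
  hasCyclicLift_prod_of_decomposes ne_iff_bne ne_iff_bne
    (L := orbit (onLeft 3 (rotate 1 7)) 7 <|
      blocksK8K3)
    (by decide +kernel)

theorem hasCyclicLift_eight_four :
    HasCyclicLift (prodRel (fun a b : Fin 8 => a ≠ b) (fun a b : Fin 4 => a ≠ b)) :=
  hasCyclicLift_prod_of_decomposes ne_iff_bne ne_iff_bne
    (L := orbit (onRight 4 (· ^^^ 2)) 2 <|
      orbit (onRight 4 (· ^^^ 1)) 2 <|
      orbit (onLeft 4 (rotate 1 7)) 7 <|
      blocksK8K4)
    (by decide +kernel)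

theorem hasCyclicLift_eight_six :
    HasCyclicLift (prodRel (fun a b : Fin 8 => a ≠ b) (fun a b : Fin 6 => a ≠ b)) :=
  hasCyclicLift_prod_of_decomposes ne_iff_bne ne_iff_bne
    (L := orbit (onRight 6 (rotate 1 5)) 5 <|
      orbit (onLeft 6 (rotate 1 7)) 7 <|
      blocksK8K6)
    (by decide +kernel)

theorem hasCyclicLift_puncturedEight_edgeLoop :
    HasCyclicLift (prodRel (punctured 8) (offHole (0 : Fin 2))) :=
  hasCyclicLift_prod_of_decomposes punctured_iff offHole_iff
    (L := orbit (onLeft 2 ((rotate 2 6)^[2])) 3 <|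
      blocksK8ES)
    (by decide +kernel)

theorem hasCyclicLift_puncturedEight_three :
    HasCyclicLift (prodRel (punctured 8) (fun a b : Fin 3 => a ≠ b)) :=
  hasCyclicLift_prod_of_decomposes punctured_iff ne_iff_bne
    (L := orbit (onRight 3 (rotate 0 3)) 3 <|
      orbit (onLeft 3 ((rotate 2 6)^[2])) 3 <|
      blocksK8EK3)
    (by decide +kernel)

theorem hasCyclicLift_puncturedEight_four :
    HasCyclicLift (prodRel (punctured 8) (fun a b : Fin 4 => a ≠ b)) :=
  hasCyclicLift_prod_of_decomposes punctured_iff ne_iff_bne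
    (L := orbit (onRight 4 (rotate 1 3)) 3 <|
      orbit (onLeft 4 (rotate 2 6)) 6 <|
      blocksK8EK4)
    (by decide +kernel)

theorem hasCyclicLift_puncturedEight_six :
    HasCyclicLift (prodRel (punctured 8) (fun a b : Fin 6 => a ≠ b)) :=
  hasCyclicLift_prod_of_decomposes punctured_iff ne_iff_bne
    (L := orbit (onRight 6 (rotate 1 5)) 5 <|
      orbit (onLeft 6 (rotate 2 6)) 6 <|
      blocksK8EK6)
    (by decide +kernel)

namespace HasCyclicLift

theorem of_forall_not {V : Type*} {E : V → V → Prop} (h : ∀ a b, ¬E a b) : HasCyclicLift E :=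
  ⟨fun _ _ _ => False, ⟨False.elim, False.elim, False.elim, fun hab => absurd hab (h _ _),
    False.elim⟩, False.elim⟩

theorem prod_assoc {A B C : Type*} {E : A → A → Prop} {F : B → B → Prop} {D : C → C → Prop}
    (h : HasCyclicLift (prodRel E (prodRel F D))) : HasCyclicLift (prodRel (prodRel E F) D) :=
  h.of_equiv (Equiv.prodAssoc A B C) fun _ _ => and_assoc

theorem prod_right_comm {A B C : Type*} {E : A → A → Prop} {F : B → B → Prop} {D : C → C → Prop}
    (h : HasCyclicLift (prodRel (prodRel E F) D)) : HasCyclicLift (prodRel (prodRel E D) F) :=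
  h.of_equiv ⟨fun x => ((x.1.1, x.2), x.1.2), fun x => ((x.1.1, x.2), x.1.2), fun _ => rfl,
    fun _ => rfl⟩ fun _ _ => and_right_comm

/-- Edge-disjoint unions of a graph and a family of graphs, all given by embeddings. -/
theorem prod_glue {A A₀ A₁ ι B : Type*} {Γ : B → B → Prop} {E : A → A → Prop}
    {E₀ : A₀ → A₀ → Prop} {E₁ : ι → A₁ → A₁ → Prop} {φ₀ : A₀ → A} {φ : ι → A₁ → A}
    (h₀ : HasCyclicLift (prodRel E₀ Γ)) (h₁ : ∀ i, HasCyclicLift (prodRel (E₁ i) Γ))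
    (hφ₀ : φ₀.Injective) (hφ : ∀ i, (φ i).Injective)
    (hE₀ : ∀ x y, E₀ x y → E (φ₀ x) (φ₀ y)) (hE₁ : ∀ i x y, E₁ i x y → E (φ i x) (φ i y))
    (hE : ∀ a b, E a b → (∃ x y, E₀ x y ∧ φ₀ x = a ∧ φ₀ y = b) ∨
      ∃ i x y, E₁ i x y ∧ φ i x = a ∧ φ i y = b)
    (hd₀ : ∀ i x y x' y', E₀ x y → E₁ i x' y' → φ₀ x = φ i x' → φ₀ y ≠ φ i y')
    (hd : ∀ i j x y x' y', E₁ i x y → E₁ j x' y' → φ i x = φ j x' → φ i y = φ j y' → i = j) :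
    HasCyclicLift (prodRel E Γ) := by
  refine prod_iUnion (fun (i : Option ι) a b => i.elim (∃ x y, E₀ x y ∧ φ₀ x = a ∧ φ₀ y = b)
    fun i => ∃ x y, E₁ i x y ∧ φ i x = a ∧ φ i y = b) ?_ (fun a b => ?_) ?_
  · rintro (_ | i)
    · exact h₀.prod_map hφ₀ fun a b => Iff.rfl
    · exact (h₁ i).prod_map (hφ i) fun a b => Iff.rfl
  · rw [Option.exists]
    refine ⟨hE a b, ?_⟩
    rintro (⟨x, y, hxy, rfl, rfl⟩ | ⟨i, x, y, hxy, rfl, rfl⟩)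
    · exact hE₀ x y hxy
    · exact hE₁ i x y hxy
  · rintro (_ | i) (_ | j) a b ⟨x, y, hxy, rfl, rfl⟩ ⟨x', y', hxy', hx, hy⟩
    · rfl
    · exact (hd₀ j x y x' y' hxy hxy' hx.symm hy.symm).elim
    · exact (hd₀ i x' y' x y hxy' hxy hx hy).elim
    · exact congrArg some (hd i j x y x' y' hxy hxy' hx.symm hy.symm)

section Groups

variable {B G S : Type*} {Γ : B → B → Prop}

/-- Filling the groups of a complete multipartite graph. -/
theorem prod_fill (hX : HasCyclicLift (prodRel (fun a b : G × S => a.1 ≠ b.1) Γ))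
    (hS : HasCyclicLift (prodRel (fun a b : S => a ≠ b) Γ)) :
    HasCyclicLift (prodRel (fun a b : G × S => a ≠ b) Γ) := by
  refine prod_glue (φ₀ := id) (φ := fun g : G => Prod.mk g) hX (fun _ => hS)
    Function.injective_id Prod.mk_right_injective (fun x y h h' => h (congrArg Prod.fst h'))
    (fun g x y h h' => h (Prod.mk_right_injective g h')) ?_ ?_ ?_
  · rintro ⟨g, x⟩ ⟨g', y⟩ h
    obtain rfl | hg := eq_or_ne g g'
    · exact Or.inr ⟨g, x, y, fun h' => h (congrArg _ h'), rfl, rfl⟩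
    · exact Or.inl ⟨_, _, hg, rfl, rfl⟩
  · rintro g ⟨g₁, x⟩ ⟨g₂, y⟩ x' y' h - h1 h2
    exact h ((congrArg Prod.fst h1).trans (congrArg Prod.fst h2).symm)
  · rintro g g' x y x' y' - - h -
    exact congrArg Prod.fst h

/-- Filling the groups of a complete multipartite graph together with a new point. -/
theorem prod_fill_option (hX : HasCyclicLift (prodRel (fun a b : G × S => a.1 ≠ b.1) Γ))
    (hS : HasCyclicLift (prodRel (fun a b : Option S => a ≠ b) Γ)) :
    HasCyclicLift (prodRel (fun a b : Option (G × S) => a ≠ b) Γ) := by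
  have inj (g : G) : (Option.map (Prod.mk (β := S) g)).Injective :=
    Option.map_injective (Prod.mk_right_injective g)
  refine prod_glue (φ₀ := some) (φ := fun g : G => Option.map (Prod.mk g)) hX (fun _ => hS)
    (Option.some_injective _) inj
    (fun x y h h' => h (congrArg Prod.fst (Option.some_injective _ h')))
    (fun g x y h h' => h (inj g h')) ?_ ?_ ?_
  · rintro (_ | ⟨g, x⟩) (_ | ⟨g', y⟩) h
    · exact absurd rfl h
    · exact Or.inr ⟨g', none, some y, by simp, rfl, rfl⟩
    · exact Or.inr ⟨g, some x, none, by simp, rfl, rfl⟩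
    · obtain rfl | hg := eq_or_ne g g'
      · exact Or.inr ⟨g, some x, some y, fun h' => h (congrArg (Option.map _) h'), rfl, rfl⟩
      · exact Or.inl ⟨_, _, hg, rfl, rfl⟩
  · rintro g ⟨g₁, x⟩ ⟨g₂, y⟩ (_ | x') (_ | y') h - h1 h2 <;> simp_all
  · rintro g g' (_ | x) (_ | y) (_ | x') (_ | y') hxy - h1 h2 <;> simp_all

/-- Filling the groups of a complete multipartite graph, all of whose points have been doubled,
together with a doubled new point. -/
theorem prod_fill_double [Nonempty G]
    (hX : HasCyclicLift (prodRel (prodRel (fun a b : G × S => a.1 ≠ b.1)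
      fun _ _ : Fin 2 => True) Γ))
    (hS : HasCyclicLift (prodRel (fun a b : Option S × Fin 2 => a ≠ b) Γ))
    (hS' : HasCyclicLift
      (prodRel (fun a b : Option S × Fin 2 => a ≠ b ∧ ¬(a.1 = none ∧ b.1 = none)) Γ)) :
    HasCyclicLift (prodRel (fun a b : Option (G × S) × Fin 2 => a ≠ b) Γ) := by
  obtain ⟨g₀⟩ := ‹Nonempty G›
  have inj (g : G) : (Prod.map (Option.map (Prod.mk (β := S) g)) (id : Fin 2 → Fin 2)).Injective :=
    (Option.map_injective (Prod.mk_right_injective g)).prodMap Function.injective_id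
  refine prod_glue (φ₀ := Prod.map some id) (φ := fun g : G => Prod.map (Option.map (Prod.mk g)) id)
    (E₁ := fun g a b => a ≠ b ∧ (a.1 = none ∧ b.1 = none → g = g₀)) hX (fun g => ?_)
    ((Option.some_injective _).prodMap Function.injective_id) inj
    (fun x y h h' => h.1 (Option.some_injective _ (congrArg Prod.fst h') ▸ rfl))
    (fun g x y h h' => h.1 (inj g h')) ?_ ?_ ?_
  · by_cases hg : g = g₀
    · simpa [hg] using hS
    · simpa only [hg, imp_false] using hS'
  · rintro ⟨_ | ⟨g, x⟩, s⟩ ⟨_ | ⟨g', y⟩, t⟩ h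
    · exact Or.inr ⟨g₀, (none, s), (none, t), ⟨by simpa using h, fun _ => rfl⟩, rfl, rfl⟩
    · exact Or.inr ⟨g', (none, s), (some y, t), by simp, rfl, rfl⟩
    · exact Or.inr ⟨g, (some x, s), (none, t), by simp, rfl, rfl⟩
    · obtain rfl | hg := eq_or_ne g g'
      · exact Or.inr ⟨g, (some x, s), (some y, t), by simpa using h, rfl, rfl⟩
      · exact Or.inl ⟨((g, x), s), ((g', y), t), ⟨hg, trivial⟩, rfl, rfl⟩
  · rintro g ⟨⟨g₁, x⟩, s⟩ ⟨⟨g₂, y⟩, t⟩ ⟨_ | x', s'⟩ ⟨_ | y', t'⟩ h - h1 h2 <;>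
      simp_all [prodRel]
  · rintro g g' ⟨_ | x, s⟩ ⟨_ | y, t⟩ ⟨_ | x', s'⟩ ⟨_ | y', t'⟩ h h' h1 h2 <;> simp_all

/-- A looped star added to a complete graph. -/
theorem prod_offHole {n : ℕ} (hn : HasCyclicLift (prodRel (fun a b : Fin n => a ≠ b) Γ))
    (hS : HasCyclicLift (prodRel (offHole (0 : Fin 2)) Γ)) :
    HasCyclicLift (prodRel (offHole (0 : Fin (n + 1))) Γ) := by
  refine prod_glue (φ₀ := Fin.succ) (φ := fun i : Fin n => ![0, i.succ]) hn (fun _ => hS)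
    (Fin.succ_injective n) (fun i => ?_) (fun x y _ h => Fin.succ_ne_zero x h.1) ?_ ?_ ?_ ?_
  · simp [Function.Injective, Fin.forall_fin_two, (Fin.succ_ne_zero i).symm, Fin.succ_ne_zero i]
  · simp [offHole, Fin.forall_fin_two]
  · intro a b
    rcases Fin.eq_zero_or_eq_succ a with rfl | ⟨i, rfl⟩ <;>
      rcases Fin.eq_zero_or_eq_succ b with rfl | ⟨j, rfl⟩ <;> intro h
    · exact absurd ⟨rfl, rfl⟩ h
    · exact Or.inr ⟨j, 0, 1, by simp [offHole], rfl, rfl⟩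
    · exact Or.inr ⟨i, 1, 0, by simp [offHole], rfl, rfl⟩
    · obtain rfl | hij := eq_or_ne i j
      · exact Or.inr ⟨i, 1, 1, by simp [offHole], rfl, rfl⟩
      · exact Or.inl ⟨i, j, hij, rfl, rfl⟩
  · simp only [Fin.forall_fin_two]
    simp +contextual only [ne_eq, Matrix.cons_val_zero, Matrix.cons_val_one, Fin.succ_ne_zero,
      not_false_eq_true, IsEmpty.forall_iff, implies_true, true_and, Fin.succ_inj]
    exact fun i x y hxy _ h h' => hxy (h.trans h'.symm)
  · simp only [Fin.forall_fin_two]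
    simp +contextual [offHole]

end Groups

/-- Inflating the groups of a complete multipartite graph. -/
theorem prod_inflate {G S B : Type*} (W : Type*) [AddCommGroup W] {Γ : B → B → Prop}
    (h : HasCyclicLift (prodRel (fun a b : G × S => a.1 ≠ b.1) Γ)) :
    HasCyclicLift (prodRel (fun a b : G × (S × W) => a.1 ≠ b.1) Γ) :=
  (h.inflate W).prod_right_comm.prod_of_equiv (Equiv.prodAssoc G S W).symm
    fun _ _ => (and_iff_left trivial).symm

/-- Complete graphs with a number of vertices not congruent to `2` modulo `3` have lifts if the
complete graphs on three, four and six vertices do. -/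
theorem prod_complete {B : Type*} {Γ : B → B → Prop}
    (h3 : HasCyclicLift (prodRel (fun a b : Fin 3 => a ≠ b) Γ))
    (h4 : HasCyclicLift (prodRel (fun a b : Fin 4 => a ≠ b) Γ))
    (h6 : HasCyclicLift (prodRel (fun a b : Fin 6 => a ≠ b) Γ)) {n : ℕ} (hn : 0 < n)
    (hn3 : n % 3 ≠ 2) : HasCyclicLift (prodRel (fun a b : Fin n => a ≠ b) Γ) := by
  have two (k : ℕ) [NeZero k] :=
    prod_of_hasTriangulation (hasTriangulation_type_two k) (fun _ h => h rfl) h3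
  have three (k : ℕ) :=
    prod_of_hasTriangulation (hasTriangulation_type_three k) (fun _ h => h rfl) h3
  obtain ⟨k, hk⟩ : ∃ k, n = 6 * k + 1 ∨ n = 6 * k + 3 ∨ n = 6 * k + 4 ∨ n = 12 * k ∨
      n = 12 * k + 6 := by
    rcases (by omega : n % 6 = 0 ∨ n % 6 = 1 ∨ n % 6 = 3 ∨ n % 6 = 4) with h | h
    · exact ⟨n / 12, by omega⟩
    · exact ⟨n / 6, by omega⟩
  rcases hk with rfl | rfl | rfl | rfl | rfl
  · obtain rfl | hk := Nat.eq_zero_or_pos k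
    · exact of_forall_not fun a b h => h.1 (Subsingleton.elim (α := Fin 1) _ _)
    · have : NeZero k := ⟨hk.ne'⟩
      refine (prod_fill_option (two k)
        (h3.prod_complete_of_card (by simp))).prod_complete_of_card ?_
      simp
      omega
  · refine (prod_fill (three k) h3).prod_complete_of_card ?_
    simp
    omega
  · refine (prod_fill_option (three k)
      (h4.prod_complete_of_card (by simp))).prod_complete_of_card ?_
    simp
    omega
  · have : NeZero k := ⟨by omega⟩
    refine (prod_fill ((two k).prod_inflate (ZMod 2))
      (h4.prod_complete_of_card (by simp))).prod_complete_of_card ?_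
    simp
    omega
  · refine (prod_fill ((three k).prod_inflate (ZMod 2))
      (h6.prod_complete_of_card (by simp))).prod_complete_of_card ?_
    simp
    omega

end HasCyclicLift

/-- The tensor product of a triangle with a complete graph with all loops but one decomposes
into triangles. -/
theorem hasTriangulation_three_offHole (A : Type*) [AddCommGroup A] :
    HasTriangulation (prodRel (fun a b : Fin 3 => a ≠ b) (offHole (0 : A))) := by
  have h3 : ∀ i j k k' : Fin 3, i ≠ j → i + j + k = 0 → i + j + k' = 0 → k = k' := by decide
  have hne : ∀ i j k : Fin 3, i ≠ j → i + j + k = 0 → j ≠ k := by decide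
  refine ⟨fun p q r => (p.1 ≠ q.1 ∧ p.1 + q.1 + r.1 = 0) ∧ offHole 0 p.2 q.2 ∧
    p.2 + q.2 + r.2 = 0, ?_, ?_, ?_, ?_, ?_⟩
  · rintro p q r ⟨⟨h1, h2⟩, h3, h4⟩
    exact ⟨⟨h1.symm, by rw [← h2]; abel⟩, fun h => h3 h.symm, by rw [← h4]; abel⟩
  · rintro ⟨i, x⟩ ⟨j, y⟩ ⟨k, z⟩ ⟨⟨h1, h2⟩, h3, h4⟩
    refine ⟨⟨hne _ _ _ h1 h2, by rw [← h2]; abel⟩, ?_, by rw [← h4]; abel⟩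
    rintro ⟨rfl, rfl⟩
    exact h3 ⟨by simpa using h4, rfl⟩
  · rintro p q r ⟨⟨h1, -⟩, h3, -⟩
    exact ⟨h1, h3⟩
  · rintro p q ⟨h1, h2⟩
    exact ⟨-(p + q), ⟨h1, by simp⟩, h2, by simp⟩
  · rintro p q r r' ⟨⟨h1, h2⟩, -, h4⟩ ⟨⟨-, h2'⟩, -, h4'⟩
    exact Prod.ext (h3 _ _ _ _ h1 h2 h2') (add_left_cancel (h4.trans h4'.symm))

/-- The tensor product of a doubled triangle with a complete graph with all loops but one has
a cyclic lift. -/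
theorem hasCyclicLift_doubled_three_offHole (A : Type*) [AddCommGroup A] :
    HasCyclicLift (prodRel (fun a b : Fin 3 => a ≠ b)
      (prodRel (fun _ _ : Fin 2 => True) (offHole (0 : A)))) :=
  ((HasCyclicLift.prod_of_hasTriangulation (hasTriangulation_three_offHole A)
    (fun _ h => h.1 rfl) hasCyclicLift_three_top).prod_right_comm).of_equiv
    (Equiv.prodAssoc _ _ _).symm fun _ _ => and_assoc.symm

/-- Filling doubled groups, with the smaller pieces on initial segments. -/
theorem HasCyclicLift.prod_fill_double_fin {A G : Type*} [AddCommGroup A] [Finite G] [Nonempty G]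
    {s u : ℕ} (hX : HasTriangulation fun a b : G × Fin s => a.1 ≠ b.1)
    (hS : HasCyclicLift (prodRel (fun a b : Fin ((s + 1) * 2) => a ≠ b) (offHole (0 : A))))
    (hS' : HasCyclicLift (prodRel (punctured ((s + 1) * 2)) (offHole (0 : A))))
    (hu : u = (Nat.card G * s + 1) * 2) :
    HasCyclicLift (prodRel (fun a b : Fin u => a ≠ b) (offHole (0 : A))) := by
  let e : Option (Fin s) × Fin 2 ≃ Fin ((s + 1) * 2) :=
    ((finSuccEquiv s).symm.prodCongr (Equiv.refl _)).trans finProdFinEquiv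
  have he (x : Option (Fin s) × Fin 2) : ((e x : Fin _) : ℕ) < 2 ↔ x.1 = none := by
    rcases x with ⟨_ | x, i⟩
    · have := i.2
      simp [e]
      omega
    · simp [e]
      omega
  refine (prod_fill_double (prod_of_hasTriangulation hX (fun _ h => h rfl)
    (hasCyclicLift_doubled_three_offHole A)).prod_assoc (hS.prod_of_equiv e fun a b => by simp)
    (hS'.prod_of_equiv e fun a b => ?_)).prod_complete_of_card ?_
  · simp only [punctured, he, ne_eq, e.apply_eq_iff_eq]
  · simp [hu]

theorem hasCyclicLift_prod_offHole {B : Type*} {Γ : B → B → Prop}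
    (h2 : HasCyclicLift (prodRel Γ (offHole (0 : Fin 2))))
    (h3 : HasCyclicLift (prodRel Γ fun a b : Fin 3 => a ≠ b))
    (h4 : HasCyclicLift (prodRel Γ fun a b : Fin 4 => a ≠ b))
    (h6 : HasCyclicLift (prodRel Γ fun a b : Fin 6 => a ≠ b)) {n : ℕ} (hn : 0 < n)
    (hn3 : n % 3 ≠ 2) : HasCyclicLift (prodRel Γ (offHole (0 : Fin (n + 1)))) :=
  (HasCyclicLift.prod_offHole (HasCyclicLift.prod_complete h3.prod_comm h4.prod_comm h6.prod_comm
    hn hn3) h2.prod_comm).prod_comm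

theorem hasCyclicLift_complete_offHole {u n : ℕ} (hu6 : u % 6 = 2) (hu : 8 ≤ u) (hn : 0 < n)
    (hn3 : n % 3 ≠ 2) :
    HasCyclicLift (prodRel (fun a b : Fin u => a ≠ b) (offHole (0 : Fin (n + 1)))) := by
  obtain ⟨k, hk⟩ : ∃ k, (0 < k ∧ u = 12 * k + 2) ∨ u = 12 * k + 8 :=
    ⟨u / 12, by omega⟩
  rcases hk with ⟨hk, rfl⟩ | rfl
  · have : NeZero k := ⟨hk.ne'⟩
    refine HasCyclicLift.prod_fill_double_fin (hasTriangulation_type_two k)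
      (hasCyclicLift_prod_offHole hasCyclicLift_six_edgeLoop hasCyclicLift_six_three
        hasCyclicLift_six_four hasCyclicLift_six_six hn hn3)
      (hasCyclicLift_prod_offHole hasCyclicLift_puncturedSix_edgeLoop
        hasCyclicLift_puncturedSix_three hasCyclicLift_puncturedSix_four
        hasCyclicLift_puncturedSix_six hn hn3) ?_
    simp
    omega
  · refine HasCyclicLift.prod_fill_double_fin (hasTriangulation_type_three k)
      (hasCyclicLift_prod_offHole hasCyclicLift_eight_edgeLoop hasCyclicLift_eight_three
        hasCyclicLift_eight_four hasCyclicLift_eight_six hn hn3)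
      (hasCyclicLift_prod_offHole hasCyclicLift_puncturedEight_edgeLoop
        hasCyclicLift_puncturedEight_three hasCyclicLift_puncturedEight_four
        hasCyclicLift_puncturedEight_six hn hn3) ?_
    simp
    omega

/-- The triangles of a cyclic lift of a tensor product are the blocks of an incomplete group
divisible design. -/
theorem HasCyclicLift.exists_isCyclicIGDDrow {u n : ℕ}
    (h : HasCyclicLift (prodRel (fun a b : Fin u => a ≠ b) (offHole (0 : Fin (n + 1))))) :
    ∃ ℬ, IsCyclicIGDDrow u (n + 1) 4 1 ℬ := by
  classical
  have hole (x y : Fin (n + 1)) : ¬((x : ℕ) < 1 ∧ (y : ℕ) < 1) ↔ offHole 0 x y := by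
    simp [offHole]
  obtain ⟨T, hT, hs⟩ : ∃ T, IsTriangulation (fun p q : Fin u × Fin (n + 1) × ZMod 4 =>
      p.1 ≠ q.1 ∧ offHole 0 p.2.1 q.2.1) T ∧ ∀ {p q r}, T p q r →
      T (p.1, p.2.1, p.2.2 + 1) (q.1, q.2.1, q.2.2 + 1) (r.1, r.2.1, r.2.2 + 1) :=
    let ⟨_, hT, hs⟩ := h
    ⟨_, hT.of_equiv (Equiv.prodAssoc _ _ _).symm fun _ _ => Iff.rfl, fun t => hs t⟩
  have irr (p : Fin u × Fin (n + 1) × ZMod 4) : ¬(p.1 ≠ p.1 ∧ offHole 0 p.2.1 p.2.1) :=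
    fun h => h.1 rfl
  refine ⟨Finset.univ.filter fun S => ∃ a b c, T a b c ∧ S = {a, b, c}, ?_, ?_, ?_, ?_⟩
  · simp only [Finset.mem_filter_univ]
    rintro _ ⟨a, b, c, t, rfl⟩
    exact hT.card_eq_three irr t
  · simp only [Finset.mem_filter_univ, hole]
    rintro _ ⟨a, b, c, t, rfl⟩ p hp q hq hpq
    obtain ⟨r, t', -⟩ := hT.exists_of_mem t hp hq hpq
    exact hT.edge t'
  · simp only [Finset.mem_filter_univ, hole]
    intro p q hpq hh
    obtain ⟨r, t⟩ := hT.exists_third (a := p) (b := q) ⟨hpq, hh⟩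
    refine ⟨{p, q, r}, ⟨⟨p, q, r, t, rfl⟩, by simp, by simp⟩, ?_⟩
    rintro _ ⟨⟨a, b, c, t', rfl⟩, hp, hq⟩
    obtain ⟨r', t'', h⟩ := hT.exists_of_mem t' hp hq fun h => hpq (congrArg Prod.fst h)
    rw [h, hT.unique t t'']
  · simp only [Finset.mem_filter_univ]
    rintro _ ⟨a, b, c, t, rfl⟩
    exact ⟨_, _, _, hs t, by simp [Finset.image_insert]⟩

/-- Let u ≡ 2 (mod 6) with u ≥ 8, and let v be a positive
integer with v ≡ 1 or 2 (mod 3) and v ≥ 2. Then there exists a 4-cyclic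
3-IGDD of type (4v,4)^u. -/
theorem exists_cyclic_igdd_4v_4_u
    (u v : ℕ) (humod : u % 6 = 2) (hu : 8 ≤ u)
    (hv : v % 3 = 1 ∨ v % 3 = 2) (hv2 : 2 ≤ v) :
    ∃ ℬ : Finset (Finset (Fin u × Fin v × ZMod 4)),
      IsCyclicIGDDrow u v 4 1 ℬ := by
  obtain ⟨n, rfl⟩ : ∃ n, v = n + 1 := ⟨v - 1, by omega⟩
  exact (hasCyclicLift_complete_offHole humod hu (by omega) (by omega)).exists_isCyclicIGDDrow
end

section
/- There exists a 3-SCGDP* of type 2^{(11,5)} with 32 base blocks. -/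
/-- A 3-SCGDP* of type 2^{(u,t)} with b base blocks: a 3-SCGDP of type 2^u
(a 2-cyclic 3-GDP on `I_u × Z_2` with groups `{i} × Z_2`: blocks of size 3,
at most one point per group, each pair from distinct groups in at most one
block, block set invariant under the shift of the second coordinate; since
each block orbit has length exactly 2, having b base blocks means having 2·b
blocks) such that additionally, for all a, b ∈ I_t and x ∈ Z_2, no block
contains both (a,x) and (b,x+1). -/
def IsSCGDPstar (u t b : ℕ) (ℬ : Finset (Finset (Fin u × ZMod 2))) : Prop :=
  ℬ.card = 2 * b ∧
  (∀ B ∈ ℬ, B.card = 3) ∧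
  (∀ B ∈ ℬ, ∀ p ∈ B, ∀ q ∈ B, p ≠ q → p.1 ≠ q.1) ∧
  (∀ p q : Fin u × ZMod 2, p.1 ≠ q.1 →
    (ℬ.filter (fun B => p ∈ B ∧ q ∈ B)).card ≤ 1) ∧
  (∀ B ∈ ℬ, B.image (fun p => (p.1, p.2 + 1)) ∈ ℬ) ∧
  (∀ a b : Fin u, (a : ℕ) < t → (b : ℕ) < t → ∀ x : ZMod 2, ∀ B ∈ ℬ,
    ¬((a, x) ∈ B ∧ (b, x + 1) ∈ B))

namespace SCGDPstar

/-- The point `(i, x)` is coded by the number `2 * i + x`. -/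
def code (p : Fin 11 × ZMod 2) : ℕ := 2 * p.1 + p.2.val

theorem code_lt (p : Fin 11 × ZMod 2) : code p < 22 := by
  have := p.1.isLt
  have := ZMod.val_lt p.2
  unfold code
  omega

theorem code_div_two (p : Fin 11 × ZMod 2) : code p / 2 = p.1 := by
  have := ZMod.val_lt p.2
  unfold code
  omega

theorem code_mod_two (p : Fin 11 × ZMod 2) : code p % 2 = p.2.val := by
  have := ZMod.val_lt p.2
  unfold code
  omega

theorem code_injective : Function.Injective code := fun p q h => by
  refine Prod.ext (Fin.ext ?_) (ZMod.val_injective 2 ?_)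
  · rw [← code_div_two, ← code_div_two, h]
  · rw [← code_mod_two, ← code_mod_two, h]

theorem exists_code_eq {n : ℕ} (hn : n < 22) : ∃ p, code p = n := by
  refine ⟨(⟨n / 2, by omega⟩, (n : ZMod 2)), ?_⟩
  simp only [code, ZMod.val_natCast]
  omega

theorem code_shift (p : Fin 11 × ZMod 2) : code (p.1, p.2 + 1) = code p ^^^ 1 := by
  obtain ⟨i, x⟩ := p
  fin_cases x <;> revert i <;> decide

/-- The set of points whose codes occur in `t`. -/
def block (t : List ℕ) : Finset (Fin 11 × ZMod 2) :=
  Finset.univ.filter fun p => code p ∈ t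

@[simp]
theorem mem_block {t : List ℕ} {p : Fin 11 × ZMod 2} : p ∈ block t ↔ code p ∈ t := by
  simp [block]

theorem card_block {t : List ℕ} (ht : t.Nodup) (hlt : ∀ n ∈ t, n < 22) :
    (block t).card = t.length := by
  rw [← List.toFinset_card_of_nodup ht, ← Finset.card_image_of_injective _ code_injective]
  congr 1
  ext n
  simp only [Finset.mem_image, mem_block, List.mem_toFinset]
  constructor
  · rintro ⟨p, hp, rfl⟩
    exact hp
  · intro hn
    obtain ⟨p, rfl⟩ := exists_code_eq (hlt n hn)
    exact ⟨p, hn, rfl⟩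

theorem image_shift_block (t : List ℕ) :
    (block t).image (fun p => (p.1, p.2 + 1)) = block (t.map (· ^^^ 1)) := by
  ext p
  simp only [Finset.mem_image, mem_block, List.mem_map]
  constructor
  · rintro ⟨q, hq, rfl⟩
    exact ⟨_, hq, (code_shift q).symm⟩
  · rintro ⟨n, hn, hp⟩
    refine ⟨(p.1, p.2 + 1), ?_, ?_⟩
    · rwa [code_shift, ← hp, Nat.xor_xor_cancel_right]
    · rw [add_assoc, CharTwo.add_self_eq_zero, add_zero]

/-- The codes of the base blocks. -/
def base : List (List ℕ) :=
  [[0, 2, 13], [0, 4, 16], [0, 6, 14], [0, 8, 10], [0, 11, 21],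
   [0, 12, 17], [0, 15, 19], [0, 18, 20], [2, 4, 15], [2, 6, 18],
   [2, 8, 21], [2, 11, 14], [2, 10, 17], [2, 12, 19], [2, 16, 20],
   [4, 6, 11], [4, 8, 12], [4, 10, 18], [4, 13, 17], [4, 14, 21],
   [4, 19, 20], [6, 8, 16], [6, 10, 19], [6, 12, 15], [6, 13, 21],
   [6, 17, 20], [8, 11, 15], [8, 13, 19], [8, 14, 20], [8, 17, 18],
   [10, 12, 21], [14, 17, 19]]

/-- The codes of the base blocks and of their translates. -/
def codes : List (List ℕ) := base ++ base.map (List.map (· ^^^ 1))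

theorem nodup_codes : codes.Nodup := by decide +kernel

theorem length_of_mem_codes : ∀ t ∈ codes, t.length = 3 := by decide +kernel

theorem lt_of_mem_codes : ∀ t ∈ codes, ∀ n ∈ t, n < 22 := by decide +kernel

theorem nodup_of_mem_codes : ∀ t ∈ codes, t.Nodup := by decide +kernel

theorem eq_of_div_two_eq : ∀ t ∈ codes, ∀ m ∈ t, ∀ n ∈ t, m / 2 = n / 2 → m = n := by
  decide +kernel

theorem eq_of_mem_codes :
    ∀ t ∈ codes, ∀ s ∈ codes, ∀ m ∈ t, m ∈ s → ∀ n ∈ t, n ∈ s → m = n ∨ t = s := by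
  decide +kernel

theorem map_xor_mem_codes : ∀ t ∈ codes, t.map (· ^^^ 1) ∈ codes := by decide +kernel

theorem mod_two_eq_of_mem_codes :
    ∀ t ∈ codes, ∀ m ∈ t, m < 10 → ∀ n ∈ t, n < 10 → m % 2 = n % 2 := by
  decide +kernel

theorem card_block_of_mem_codes {t : List ℕ} (ht : t ∈ codes) : (block t).card = 3 := by
  rw [card_block (nodup_of_mem_codes t ht) (lt_of_mem_codes t ht), length_of_mem_codes t ht]

theorem eq_of_mem_block {t s : List ℕ} (ht : t ∈ codes) (hs : s ∈ codes)
    {p q : Fin 11 × ZMod 2} (hpq : p ≠ q) (hpt : p ∈ block t) (hqt : q ∈ block t)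
    (hps : p ∈ block s) (hqs : q ∈ block s) : t = s := by
  rw [mem_block] at hpt hqt hps hqs
  exact (eq_of_mem_codes t ht s hs _ hpt hps _ hqt hqs).resolve_left (code_injective.ne hpq)

theorem block_injOn : Set.InjOn block {t | t ∈ codes} := fun t ht s hs h => by
  obtain ⟨p, hp, q, hq, hpq⟩ :=
    Finset.one_lt_card.1 (by rw [card_block_of_mem_codes ht]; norm_num : 1 < (block t).card)
  exact eq_of_mem_block ht hs hpq hp hq (h ▸ hp) (h ▸ hq)

end SCGDPstar

open SCGDPstar in
/-- There exists a 3-SCGDP* of type 2^{(11,5)} with 32 base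
blocks. -/
theorem exists_scgdpstar_11_5 :
    ∃ ℬ : Finset (Finset (Fin 11 × ZMod 2)), IsSCGDPstar 11 5 32 ℬ := by
  refine ⟨codes.toFinset.image block, ?_, ?_, ?_, ?_, ?_, ?_⟩
  · rw [Finset.card_image_of_injOn (by simpa using block_injOn),
      List.toFinset_card_of_nodup nodup_codes]
    rfl
  · simpa using fun t => card_block_of_mem_codes (t := t)
  · simp only [Finset.forall_mem_image, List.mem_toFinset, mem_block]
    intro t ht p hp q hq hpq h
    refine hpq (code_injective (eq_of_div_two_eq t ht _ hp _ hq ?_))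
    rw [code_div_two, code_div_two, h]
  · intro p q hpq
    refine Finset.card_le_one.2 fun B hB C hC => ?_
    simp only [Finset.mem_filter, Finset.mem_image, List.mem_toFinset] at hB hC
    obtain ⟨⟨t, ht, rfl⟩, hpt, hqt⟩ := hB
    obtain ⟨⟨s, hs, rfl⟩, hps, hqs⟩ := hC
    rw [eq_of_mem_block ht hs (ne_of_apply_ne Prod.fst hpq) hpt hqt hps hqs]
  · simp only [Finset.forall_mem_image, List.mem_toFinset, image_shift_block]
    exact fun t ht => Finset.mem_image_of_mem _ (List.mem_toFinset.2 (map_xor_mem_codes t ht))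
  · simp only [Finset.forall_mem_image, List.mem_toFinset, mem_block]
    rintro a b ha hb x t ht ⟨hp, hq⟩
    have hx := mod_two_eq_of_mem_codes t ht
      _ hp (by have := code_div_two (a, x); dsimp only at this; omega)
      _ hq (by have := code_div_two (b, x + 1); dsimp only at this; omega)
    rw [code_mod_two, code_mod_two] at hx
    exact absurd (ZMod.val_injective 2 hx) (by simp)
end
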